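/- arXiv:1204.6690 — 2 statements merged into one kernel-verified Lean document; each statement's English description precedes it below -/
import Mathlib

section
/- Let f : B^n → C^n be continuous on the closed unit ball, hyperbolic-harmonic in each component on B^n, and satisfy |f(z)| ≤ M for all z ∈ B^n, where M > 0. Then for every z ∈ B^n, | f(z) − ((1−|z|)/(1+|z|))^{2n−1} f(0) | ≤ M [ 1 − ((1−|z|)/(1+|z|))^{2n−1} ]. -/
open MeasureTheory Metric Complex

noncomputable section

/-- `ℂⁿ` with the Euclidean norm. -/
abbrev Cn (n : ℕ) := EuclideanSpace ℂ (Fin n)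

/-- The Wirtinger derivative `∂f/∂z_k = (∂f/∂x_k - i ∂f/∂y_k)/2`. -/
noncomputable def wdz (n : ℕ) (f : Cn n → ℂ) (z : Cn n) (k : Fin n) : ℂ :=
  (1 / 2 : ℂ) *
    (fderiv ℝ f z (EuclideanSpace.single k 1) -
      Complex.I * fderiv ℝ f z (EuclideanSpace.single k Complex.I))

/-- The Wirtinger derivative `∂f/∂z̄_k = (∂f/∂x_k + i ∂f/∂y_k)/2`. -/
noncomputable def wdzbar (n : ℕ) (f : Cn n → ℂ) (z : Cn n) (k : Fin n) : ℂ :=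
  (1 / 2 : ℂ) *
    (fderiv ℝ f z (EuclideanSpace.single k 1) +
      Complex.I * fderiv ℝ f z (EuclideanSpace.single k Complex.I))

/-- Euclidean norm of a vector of complex numbers. -/
noncomputable def euclNorm (n : ℕ) (v : Fin n → ℂ) : ℝ :=
  Real.sqrt (∑ k, Complex.normSq (v k))

/-- The Laplace–Beltrami operator
`Δ_h u = (1-|z|²)² Σ_k (u_{x_k x_k} + u_{y_k y_k})
  + 4(n-1)(1-|z|²) Σ_k (x_k u_{x_k} + y_k u_{y_k})`. -/
noncomputable def laplaceH (n : ℕ) (u : Cn n → ℝ) (z : Cn n) : ℝ :=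
  (1 - ‖z‖ ^ 2) ^ 2 *
      ∑ k, (fderiv ℝ (fun w => fderiv ℝ u w (EuclideanSpace.single k 1)) z
              (EuclideanSpace.single k 1) +
            fderiv ℝ (fun w => fderiv ℝ u w (EuclideanSpace.single k Complex.I)) z
              (EuclideanSpace.single k Complex.I)) +
    4 * ((n : ℝ) - 1) * (1 - ‖z‖ ^ 2) *
      ∑ k, ((z k).re * fderiv ℝ u z (EuclideanSpace.single k 1) +
            (z k).im * fderiv ℝ u z (EuclideanSpace.single k Complex.I))

/-- A complex-valued function on the unit ball of `ℂⁿ` is hyperbolic-harmonic if it is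
twice continuously differentiable there and its real and imaginary parts are annihilated
by the Laplace–Beltrami operator. -/
def IsHHarmonic (n : ℕ) (f : Cn n → ℂ) : Prop :=
  ContDiffOn ℝ 2 f (ball 0 1) ∧
    ∀ z ∈ ball (0 : Cn n) 1,
      laplaceH n (fun w => (f w).re) z = 0 ∧ laplaceH n (fun w => (f w).im) z = 0

section Helpers

open Filter Topology

/-- two-jet at `0` of a real function of one variable. -/
def J2 (g : ℝ → ℝ) (a b : ℝ) : Prop :=
  ∃ g' : ℝ → ℝ, (∀ᶠ s in 𝓝 (0 : ℝ), HasDerivAt g (g' s) s) ∧ g' 0 = a ∧ HasDerivAt g' b 0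

lemma J2.add {g h : ℝ → ℝ} {a b c d : ℝ} (hg : J2 g a b) (hh : J2 h c d) :
    J2 (fun s => g s + h s) (a + c) (b + d) := by
  obtain ⟨g', h1, h2, h3⟩ := hg
  obtain ⟨k', k1, k2, k3⟩ := hh
  refine ⟨fun s => g' s + k' s, ?_, by simp [h2, k2], h3.add k3⟩
  filter_upwards [h1, k1] with s u v using u.add v

lemma J2.sub {g h : ℝ → ℝ} {a b c d : ℝ} (hg : J2 g a b) (hh : J2 h c d) :
    J2 (fun s => g s - h s) (a - c) (b - d) := by
  obtain ⟨g', h1, h2, h3⟩ := hg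
  obtain ⟨k', k1, k2, k3⟩ := hh
  refine ⟨fun s => g' s - k' s, ?_, by simp [h2, k2], h3.sub k3⟩
  filter_upwards [h1, k1] with s u v using u.sub v

lemma J2.const_mul {g : ℝ → ℝ} {a b : ℝ} (c : ℝ) (hg : J2 g a b) :
    J2 (fun s => c * g s) (c * a) (c * b) := by
  obtain ⟨g', h1, h2, h3⟩ := hg
  refine ⟨fun s => c * g' s, ?_, by simp [h2], h3.const_mul c⟩
  filter_upwards [h1] with s u using u.const_mul c

lemma J2.comp {g φ φ' : ℝ → ℝ} {a b c : ℝ} (hg : J2 g a b)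
    (h1 : ∀ᶠ y in 𝓝 (g 0), HasDerivAt φ (φ' y) y) (h2 : HasDerivAt φ' c (g 0)) :
    J2 (fun s => φ (g s)) (φ' (g 0) * a) (c * a ^ 2 + φ' (g 0) * b) := by
  obtain ⟨g', k1, k2, k3⟩ := hg
  have hd := k1.self_of_nhds
  refine ⟨fun s => φ' (g s) * g' s, ?_, by simp [k2], ?_⟩
  · filter_upwards [k1, hd.continuousAt.eventually h1] with s u v
    exact v.comp s u
  · have := (h2.comp (0:ℝ) hd).mul k3
    refine this.congr_deriv ?_
    simp only [k2, Function.comp]; ring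

lemma J2.congr {g h : ℝ → ℝ} {a b : ℝ} (hg : J2 g a b) (e : h =ᶠ[𝓝 0] g) : J2 h a b := by
  obtain ⟨g', k1, k2, k3⟩ := hg
  refine ⟨g', ?_, k2, k3⟩
  filter_upwards [k1, e.eventually_nhds] with s u v
  exact u.congr_of_eventuallyEq v

lemma J2.cont {g : ℝ → ℝ} {a b : ℝ} (hg : J2 g a b) : ContinuousAt g 0 := by
  obtain ⟨g', k1, k2, k3⟩ := hg
  exact k1.self_of_nhds.continuousAt

lemma J2.log {g : ℝ → ℝ} {a b : ℝ} (hg : J2 g a b) (h0 : 0 < g 0) :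
    J2 (fun s => Real.log (g s)) (a / g 0) (b / g 0 - (a / g 0) ^ 2) := by
  have := hg.comp (φ := Real.log) (φ' := fun y => y⁻¹) (c := -(g 0 ^ 2)⁻¹) ?_ ?_
  · convert this using 1
    · field_simp
    · field_simp; ring
  · filter_upwards [lt_mem_nhds h0] with y hy using Real.hasDerivAt_log hy.ne'
  · exact hasDerivAt_inv h0.ne'

lemma J2.quad (p q r : ℝ) : J2 (fun s => p + q * s + r * s ^ 2) q (2 * r) := by
  refine ⟨fun s => q + 2 * r * s, ?_, by simp, ?_⟩
  · filter_upwards with s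
    have := (((hasDerivAt_id s).const_mul q).const_add p).add (((hasDerivAt_id s).pow 2).const_mul r)
    refine this.congr_deriv ?_
    simp only [id]; push_cast; ring
  · simpa using ((hasDerivAt_id (0:ℝ)).const_mul (2 * r)).const_add q

lemma J2.min {g : ℝ → ℝ} {a b : ℝ} (hg : J2 g a b) (hm : IsLocalMin g 0) : a = 0 ∧ 0 ≤ b := by
  obtain ⟨g', k1, k2, k3⟩ := hg
  have ha : a = 0 := by rw [← k2]; exact hm.hasDerivAt_eq_zero k1.self_of_nhds
  refine ⟨ha, ?_⟩
  by_contra! hb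
  have e : deriv g =ᶠ[𝓝 0] g' := by
    filter_upwards [k1] with s u using u.deriv
  have hmax : IsLocalMax g 0 := by
    have h' : IsLocalMin (fun s => - g s) 0 := by
      apply isLocalMin_of_deriv_deriv_pos
      · have e2 : deriv (fun s => - g s) =ᶠ[𝓝 0] fun s => - g' s := by
          filter_upwards [k1] with s u using u.neg.deriv
        have h5 : deriv (fun s => - g' s) 0 = -b := k3.neg.deriv
        rw [e2.deriv_eq, h5]; linarith
      · have h5 : deriv (fun s => - g s) 0 = -(g' 0) := k1.self_of_nhds.neg.deriv
        rw [h5]; simp [k2, ha]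
      · exact k1.self_of_nhds.continuousAt.neg
    simpa using h'.neg
  have hc : g =ᶠ[𝓝 0] fun _ => g 0 := by
    filter_upwards [hm, hmax] with s u v using le_antisymm v u
  have : deriv (deriv g) 0 = 0 := by
    have h1 : deriv g =ᶠ[𝓝 0] deriv fun _ => g 0 := hc.deriv
    rw [h1.deriv_eq]; simp
  rw [e.deriv_eq, k3.deriv] at this
  linarith

noncomputable def chi (l : ℝ) : ℝ := 2 * Real.arsinh (Real.exp (l / 2))
noncomputable def tau (l : ℝ) : ℝ := Real.exp (l / 2) / √(1 + Real.exp (l / 2) ^ 2)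

lemma chi_deriv (l : ℝ) : HasDerivAt chi (tau l) l := by
  have h1 : HasDerivAt (fun l : ℝ => Real.exp (l / 2)) (Real.exp (l / 2) * (1 / 2)) l :=
    ((hasDerivAt_id l).div_const 2).exp
  have := h1.arsinh.const_mul 2
  refine this.congr_deriv ?_
  simp only [tau, smul_eq_mul]; ring

lemma tau_deriv (l : ℝ) : HasDerivAt tau (tau l * (1 - tau l ^ 2) / 2) l := by
  have h1 : HasDerivAt (fun l : ℝ => Real.exp (l / 2)) (Real.exp (l / 2) * (1 / 2)) l :=
    ((hasDerivAt_id l).div_const 2).exp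
  have hp : 0 < 1 + Real.exp (l / 2) ^ 2 := by positivity
  have h2 := ((h1.pow 2).const_add 1).sqrt hp.ne'
  have h3 := h1.div h2 (Real.sqrt_pos.2 hp).ne'
  refine h3.congr_deriv ?_
  have hs : √(1 + Real.exp (l / 2) ^ 2) ^ 2 = 1 + Real.exp (l / 2) ^ 2 := Real.sq_sqrt hp.le
  have hs' := Real.sqrt_pos.2 hp
  simp only [tau, Pi.pow_apply]
  set S := √(1 + Real.exp (l / 2) ^ 2)
  set e := Real.exp (l / 2)
  field_simp
  push_cast
  ring_nf

lemma J2.chi {g : ℝ → ℝ} {a b : ℝ} (hg : J2 g a b) :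
    J2 (fun s => chi (g s)) (tau (g 0) * a)
      (tau (g 0) * (1 - tau (g 0) ^ 2) / 2 * a ^ 2 + tau (g 0) * b) :=
  hg.comp (Eventually.of_forall chi_deriv) (tau_deriv _)

variable {E : Type*} [NormedAddCommGroup E] [InnerProductSpace ℝ E]

lemma J2.line {u : E → ℝ} {x : E} (hu : ContDiffAt ℝ 2 u x) (v : E) :
    J2 (fun s => u (x + s • v)) (fderiv ℝ u x v) (fderiv ℝ (fderiv ℝ u) x v v) := by
  have hl : ∀ s : ℝ, HasDerivAt (fun s : ℝ => x + s • v) v s := fun s => by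
    simpa using ((hasDerivAt_id s).smul_const v).const_add x
  have hc : Tendsto (fun s : ℝ => x + s • v) (𝓝 0) (𝓝 x) := by
    simpa using (hl 0).continuousAt.tendsto
  refine ⟨fun s => fderiv ℝ u (x + s • v) v, ?_, by simp, ?_⟩
  · have := hc.eventually (hu.eventually (by simp))
    filter_upwards [this] with s hs
    exact (hs.differentiableAt (by norm_num)).hasFDerivAt.comp_hasDerivAt s (hl s)
  · have hd : DifferentiableAt ℝ (fderiv ℝ u) x :=
      (hu.fderiv_right (m := 1) (by norm_num)).differentiableAt (by norm_num)
    have h0 : HasFDerivAt (fderiv ℝ u) (fderiv ℝ (fderiv ℝ u) x) (x + (0:ℝ) • v) := by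
      simpa using hd.hasFDerivAt
    have := h0.comp_hasDerivAt (0:ℝ) (hl 0)
    simpa using this.clm_apply (hasDerivAt_const (0:ℝ) v)

local notation "⟪" x ", " y "⟫" => inner ℝ x y

noncomputable def del (x y : E) : ℝ := ‖x - y‖ ^ 2 / ((1 - ‖x‖ ^ 2) * (1 - ‖y‖ ^ 2))
noncomputable def hdist (x y : E) : ℝ := 2 * Real.arsinh (√(del x y))

lemma one_sub_pos {x : E} (hx : x ∈ ball (0 : E) 1) : 0 < 1 - ‖x‖ ^ 2 := by
  rw [mem_ball_zero_iff] at hx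
  nlinarith [norm_nonneg x]

lemma exp_l {N A B : ℝ} (hN : 0 < N) (hA : 0 < A) (hB : 0 < B) :
    Real.exp ((Real.log N - Real.log A - Real.log B) / 2) = √(N / (A * B)) := by
  rw [Real.exp_half, Real.exp_sub, Real.exp_sub, Real.exp_log hN, Real.exp_log hA, Real.exp_log hB,
    div_div]

lemma hdist_eq {x y : E} (hxy : x ≠ y) (hx : x ∈ ball (0 : E) 1) (hy : y ∈ ball (0 : E) 1) :
    hdist x y = chi (Real.log (‖x - y‖ ^ 2) - Real.log (1 - ‖x‖ ^ 2) - Real.log (1 - ‖y‖ ^ 2)) := by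
  have hN : 0 < ‖x - y‖ ^ 2 := by have := norm_pos_iff.2 (sub_ne_zero.2 hxy); positivity
  rw [chi, exp_l hN (one_sub_pos hx) (one_sub_pos hy), hdist, del]

lemma tau_eq {N A B τ : ℝ} (hN : 0 < N) (hA : 0 < A) (hB : 0 < B) (hτ : 0 < τ)
    (h : τ ^ 2 * (N + A * B) = N) : tau (Real.log N - Real.log A - Real.log B) = τ := by
  rw [tau, exp_l hN hA hB, Real.sq_sqrt (by positivity), ← Real.sqrt_div (by positivity)]
  rw [show N / (A * B) / (1 + N / (A * B)) = τ ^ 2 by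
    field_simp; linarith]
  exact Real.sqrt_sq hτ.le

lemma J2.normsq (x v : E) : J2 (fun s => ‖x + s • v‖ ^ 2) (2 * ⟪x, v⟫) (2 * ‖v‖ ^ 2) := by
  have := J2.quad (‖x‖ ^ 2) (2 * ⟪x, v⟫) (‖v‖ ^ 2)
  convert this using 2 with s
  rw [norm_add_sq_real, inner_smul_right, norm_smul, mul_pow, Real.norm_eq_abs, sq_abs]; ring

lemma J2.one_sub_normsq (x v : E) :
    J2 (fun s => 1 - ‖x + s • v‖ ^ 2) (-(2 * ⟪x, v⟫)) (-(2 * ‖v‖ ^ 2)) := by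
  have := (J2.quad 1 0 0).sub (J2.normsq x v)
  simpa using this

lemma tendsto_line (x v : E) : Tendsto (fun s : ℝ => x + s • v) (𝓝 0) (𝓝 x) := by
  have : Continuous (fun s : ℝ => x + s • v) := by fun_prop
  simpa using this.tendsto 0

lemma hdist_jet {x y : E} (hxy : x ≠ y) (hx : x ∈ ball (0 : E) 1) (hy : y ∈ ball (0 : E) 1)
    {N A B τ p q : ℝ} (hN : N = ‖x - y‖ ^ 2) (hA : A = 1 - ‖x‖ ^ 2) (hB : B = 1 - ‖y‖ ^ 2)
    (hτ : 0 < τ) (h : τ ^ 2 * (N + A * B) = N) (v w : E)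
    (hp : p = 2 * ⟪x - y, v - w⟫ / N + 2 * ⟪x, v⟫ / A + 2 * ⟪y, w⟫ / B)
    (hq : q = 2 * ‖v - w‖ ^ 2 / N - (2 * ⟪x - y, v - w⟫ / N) ^ 2 + 2 * ‖v‖ ^ 2 / A
      + (2 * ⟪x, v⟫ / A) ^ 2 + 2 * ‖w‖ ^ 2 / B + (2 * ⟪y, w⟫ / B) ^ 2) :
    J2 (fun s => hdist (x + s • v) (y + s • w)) (τ * p)
      (τ * (1 - τ ^ 2) / 2 * p ^ 2 + τ * q) := by
  have hN0 : 0 < ‖x - y‖ ^ 2 := by have := norm_pos_iff.2 (sub_ne_zero.2 hxy); positivity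
  have hA0 := one_sub_pos hx
  have hB0 := one_sub_pos hy
  have h1 := (((J2.normsq (x - y) (v - w)).log (by simpa using hN0)).sub
    ((J2.one_sub_normsq x v).log (by simpa using hA0))).sub
    ((J2.one_sub_normsq y w).log (by simpa using hB0))
  have h2 := h1.chi
  simp only [zero_smul, add_zero] at h2
  rw [tau_eq hN0 hA0 hB0 hτ (by rw [← hN, ← hA, ← hB]; exact h), ← hN, ← hA, ← hB] at h2
  have h3 : (2 * ⟪x - y, v - w⟫ / N - -(2 * ⟪x, v⟫) / A - -(2 * ⟪y, w⟫) / B) = p := by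
    rw [hp]; ring
  have h4 : (2 * ‖v - w‖ ^ 2 / N - (2 * ⟪x - y, v - w⟫ / N) ^ 2 -
      (-(2 * ‖v‖ ^ 2) / A - (-(2 * ⟪x, v⟫) / A) ^ 2) -
      (-(2 * ‖w‖ ^ 2) / B - (-(2 * ⟪y, w⟫) / B) ^ 2)) = q := by
    rw [hq]; ring
  rw [h3, h4] at h2
  refine h2.congr ?_
  have t1 := (tendsto_line x v).eventually (isOpen_ball.mem_nhds hx)
  have t2 := (tendsto_line y w).eventually (isOpen_ball.mem_nhds hy)
  have t3 := ((tendsto_line x v).sub (tendsto_line y w)).eventually_ne (sub_ne_zero.2 hxy)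
  filter_upwards [t1, t2, t3] with s s1 s2 s3
  rw [hdist_eq (sub_ne_zero.1 s3) s1 s2]
  congr 5
  congr 1
  rw [smul_sub]; abel_nf

lemma final_id (N A B τ t m : ℝ) (hN : 0 < N) (hτ : 0 < τ)
    (h : τ ^ 2 * (N + A * B) = N) (ht : t * (1 + τ) = 1 - τ) :
    2 * (1 - τ ^ 2) * (1 + t) ^ 2 / τ
      + τ * (m * (2 * (A ^ 2 + t ^ 2 * B ^ 2 - 2 * t * A * B) / N + 2 * A + 2 * t ^ 2 * B)
        + (8 * t * A * B - 4 * (A + t * B) ^ 2) / N + 4 * (1 - A) + 4 * t ^ 2 * (1 - B))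
      + 4 * (m - 2) * τ * (1 + (A * B - A ^ 2) / (2 * N) - A / 2
          + t ^ 2 * (1 + (A * B - B ^ 2) / (2 * N) - B / 2))
    = 4 * (1 - t ^ 2) * (m - 1) := by
  have h1 : A * B = N * (1 - τ ^ 2) / τ ^ 2 := by field_simp; linarith
  have ht' : t = (1 - τ) / (1 + τ) := by field_simp; linarith
  have e : 2 * (1 - τ ^ 2) * (1 + t) ^ 2 / τ
      + τ * (m * (2 * (A ^ 2 + t ^ 2 * B ^ 2 - 2 * t * A * B) / N + 2 * A + 2 * t ^ 2 * B)
        + (8 * t * A * B - 4 * (A + t * B) ^ 2) / N + 4 * (1 - A) + 4 * t ^ 2 * (1 - B))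
      + 4 * (m - 2) * τ * (1 + (A * B - A ^ 2) / (2 * N) - A / 2
          + t ^ 2 * (1 + (A * B - B ^ 2) / (2 * N) - B / 2))
     = 2 * (1 - τ ^ 2) * (1 + t) ^ 2 / τ + 
       m * τ * (2 * (1 - t) ^ 2 * (A * B) / N + 4 + 4 * t ^ 2)
       - 4 * τ * (1 + t ^ 2) - 4 * τ * (1 + t ^ 2) * (A * B) / N + 4 * τ * (1 + t^2) - 4 * τ * (1 + t^2) := by
    field_simp; ring
  rw [e, h1, ht']
  field_simp
  ring

lemma trace_refl {ι : Type*} [Fintype ι] (b : OrthonormalBasis ι ℝ E) (H : E →L[ℝ] E →L[ℝ] ℝ)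
    (w : E) {N : ℝ} (hN : N = ‖w‖ ^ 2) (hN0 : 0 < N) :
    ∑ i, H (b i - (2 * ⟪b i, w⟫ / N) • w) (b i - (2 * ⟪b i, w⟫ / N) • w) = ∑ i, H (b i) (b i) := by
  have e : ∀ i, H (b i - (2 * ⟪b i, w⟫ / N) • w) (b i - (2 * ⟪b i, w⟫ / N) • w)
      = H (b i) (b i) - 2 / N * (H (⟪b i, w⟫ • b i) w) - 2 / N * (H w (⟪b i, w⟫ • b i))
        + 4 / N ^ 2 * H w w * ⟪b i, w⟫ ^ 2 := by
    intro i
    simp only [map_sub, map_smul, _root_.sub_apply, _root_.smul_apply, smul_eq_mul]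
    ring
  simp only [e, Finset.sum_add_distrib, Finset.sum_sub_distrib, ← Finset.mul_sum]
  rw [← map_sum, b.sum_sq_inner_right, ← hN]
  have h2 : ∑ i, H (⟪b i, w⟫ • b i) w = H w w := by
    have h3 := congrArg (fun v => H v w) (b.sum_repr' w)
    simp only [map_sum, _root_.sum_apply] at h3
    exact h3
  rw [h2, b.sum_repr']
  field_simp; ring

set_option maxHeartbeats 2000000 in
lemma core {ι : Type*} [Fintype ι] (b : OrthonormalBasis ι ℝ E) (u : E → ℝ) (x y : E)
    (hxy : x ≠ y) (hx : x ∈ ball (0 : E) 1) (hy : y ∈ ball (0 : E) 1)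
    (ux : 0 < u x) (uy : 0 < u y) (cx : ContDiffAt ℝ 2 u x) (cy : ContDiffAt ℝ 2 u y)
    (m l : ℝ) (hm : m = Fintype.card ι) (hl0 : 0 < l) (hl : m - 1 < l)
    (hax : (1 - ‖x‖ ^ 2) * (∑ i, fderiv ℝ (fderiv ℝ u) x (b i) (b i))
      + 2 * (m - 2) * fderiv ℝ u x x = 0)
    (hay : (1 - ‖y‖ ^ 2) * (∑ i, fderiv ℝ (fderiv ℝ u) y (b i) (b i))
      + 2 * (m - 2) * fderiv ℝ u y y = 0)
    (hmin : ∀ x' ∈ ball (0 : E) 1, ∀ y' ∈ ball (0 : E) 1,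
      Real.log (u x) - Real.log (u y) + l * hdist x y
        ≤ Real.log (u x') - Real.log (u y') + l * hdist x' y') : False := by
  obtain ⟨N, hN⟩ : ∃ N, N = ‖x - y‖ ^ 2 := ⟨_, rfl⟩
  obtain ⟨A, hA⟩ : ∃ A, A = 1 - ‖x‖ ^ 2 := ⟨_, rfl⟩
  obtain ⟨B, hB⟩ : ∃ B, B = 1 - ‖y‖ ^ 2 := ⟨_, rfl⟩
  have hN0 : 0 < N := by
    have := norm_pos_iff.2 (sub_ne_zero.2 hxy); rw [hN]; positivity
  have hA0 : 0 < A := hA ▸ one_sub_pos hx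
  have hB0 : 0 < B := hB ▸ one_sub_pos hy
  obtain ⟨τ, hτd⟩ : ∃ τ, τ = √(N / (N + A * B)) := ⟨_, rfl⟩
  have hτ : 0 < τ := by rw [hτd]; positivity
  have hτ2 : τ ^ 2 = N / (N + A * B) := by rw [hτd, Real.sq_sqrt (by positivity)]
  have h : τ ^ 2 * (N + A * B) = N := by rw [hτ2]; field_simp
  have hτ1 : τ < 1 := by
    have : τ ^ 2 < 1 := by
      rw [hτ2, div_lt_one (by positivity)]; nlinarith [mul_pos hA0 hB0]
    nlinarith
  obtain ⟨t, ht⟩ : ∃ t, t = (1 - τ) / (1 + τ) := ⟨_, rfl⟩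
  have ht' : t * (1 + τ) = 1 - τ := by rw [ht]; field_simp
  have ht0 : 0 < t := by rw [ht]; apply div_pos <;> linarith
  have ht1 : t < 1 := by rw [ht, div_lt_one] <;> linarith
  rw [← hA] at hax
  rw [← hB] at hay
  have jet := fun (v w : E) =>
    (((J2.line cx v).log (by simpa using ux)).sub ((J2.line cy w).log (by simpa using uy))).add
      ((hdist_jet hxy hx hy hN hA hB hτ h v w rfl rfl).const_mul l)
  have loc := fun (v w : E) => (jet v w).min (by
    have t1 := (tendsto_line x v).eventually (isOpen_ball.mem_nhds hx)
    have t2 := (tendsto_line y w).eventually (isOpen_ball.mem_nhds hy)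
    filter_upwards [t1, t2] with s s1 s2
    simpa using hmin _ s1 _ s2)
  simp only [zero_smul, add_zero] at loc
  set D := fderiv ℝ u x with hD
  set D' := fderiv ℝ u y with hD'
  set H := fderiv ℝ (fderiv ℝ u) x with hH
  set H' := fderiv ℝ (fderiv ℝ u) y with hH'
  have gx : ∀ v, D v / u x = - (l * τ * (2 * ⟪x - y, v⟫ / N + 2 * ⟪x, v⟫ / A)) := by
    intro v
    have := (loc v 0).1
    simp only [map_zero, sub_zero, inner_zero_right, zero_div, mul_zero, add_zero] at this
    linarith
  have gy : ∀ w, D' w / u y = l * τ * (- 2 * ⟪x - y, w⟫ / N + 2 * ⟪y, w⟫ / B) := by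
    intro w
    have := (loc 0 w).1
    simp only [map_zero, zero_sub, inner_zero_right, zero_div, mul_zero, add_zero, inner_neg_right] at this
    linear_combination -this
  -- scalar products
  obtain ⟨P, hP⟩ : ∃ P, P = ⟪x, y⟫ := ⟨_, rfl⟩
  have hX : ⟪x, x⟫ = 1 - A := by rw [real_inner_self_eq_norm_sq, hA]; ring
  have hY : ⟪y, y⟫ = 1 - B := by rw [real_inner_self_eq_norm_sq, hB]; ring
  have hyx : ⟪y, x⟫ = P := by rw [hP, real_inner_comm]
  have hNP : N = 2 - A - B - 2 * P := by
    rw [hN, norm_sub_sq_real, ← real_inner_self_eq_norm_sq, ← real_inner_self_eq_norm_sq, hX, hY, ← hP]; ring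
  obtain ⟨z, hz⟩ : ∃ z : E, z = (A / N) • (x - y) + x := ⟨_, rfl⟩
  obtain ⟨ζ, hζ⟩ : ∃ ζ : E, ζ = y - (2 * (P - (1 - B)) / N) • (x - y) := ⟨_, rfl⟩
  obtain ⟨w, hw⟩ : ∃ w : E, w = x - y := ⟨_, rfl⟩
  have hww : ‖w‖ ^ 2 = N := by rw [hw, hN]
  have hzz : ‖z‖ ^ 2 = 1 / τ ^ 2 := by
    rw [hz, ← real_inner_self_eq_norm_sq]
    simp only [inner_add_left, inner_add_right, inner_sub_left, inner_sub_right, inner_smul_left, inner_smul_right, hX, hY, ← hP, hyx]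
    simp only [conj_trivial]
    rw [hτ2]
    have : P = (2 - A - B - N) / 2 := by linarith
    rw [this]
    field_simp
    ring
  have hζζ : ‖ζ‖ ^ 2 = 1 - B := by
    rw [hζ, ← real_inner_self_eq_norm_sq]
    simp only [inner_add_left, inner_add_right, inner_sub_left, inner_sub_right, inner_smul_left, inner_smul_right, hX, hY, ← hP, hyx]
    simp only [conj_trivial]
    have : P = (2 - A - B - N) / 2 := by linarith
    rw [this]
    field_simp
    ring
  have hxx : ‖x‖ ^ 2 = 1 - A := by rw [hA]; ring
  have key : ∀ i, 0 ≤ (-4 * l ^ 2 * τ ^ 2 * (1 - t ^ 2) + l * (2 * τ * (1 - τ ^ 2) * (1 + t) ^ 2)) * ⟪b i, z⟫ ^ 2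
      + l * τ * (2 * (A ^ 2 + t ^ 2 * B ^ 2 - 2 * t * A * B) / N + 2 * A + 2 * t ^ 2 * B)
      + l * τ * ((8 * t * A * B - 4 * (A + t * B) ^ 2) / N ^ 2) * ⟪b i, w⟫ ^ 2
      + 4 * l * τ * ⟪b i, x⟫ ^ 2 + 4 * l * τ * t ^ 2 * ⟪b i, ζ⟫ ^ 2
      + A ^ 2 / u x * H (b i) (b i)
      - t ^ 2 * B ^ 2 / u y * H' (b i - (2 * ⟪b i, w⟫ / N) • w) (b i - (2 * ⟪b i, w⟫ / N) • w) := by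
    intro i
    obtain ⟨ρ, hρ⟩ : ∃ ρ, ρ = b i - (2 * ⟪b i, w⟫ / N) • w := ⟨_, rfl⟩
    have h2 := (loc (A • b i) ((t * B) • ρ)).2
    rw [← hρ]
    rw [gx, gy] at h2
    have hbb : ⟪b i, b i⟫ = 1 := by simp
    obtain ⟨ξ, hξ⟩ : ∃ ξ, ξ = ⟪b i, x⟫ := ⟨_, rfl⟩
    obtain ⟨η, hη⟩ : ∃ η, η = ⟪b i, y⟫ := ⟨_, rfl⟩
    have hξ' : ⟪x, b i⟫ = ξ := by rw [hξ, real_inner_comm]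
    have hη' : ⟪y, b i⟫ = η := by rw [hη, real_inner_comm]
    have r1 : ⟪w, b i⟫ = ξ - η := by rw [hw, inner_sub_left, hξ', hη']
    have r1' : ⟪b i, w⟫ = ξ - η := by rw [real_inner_comm, r1]
    have hwi : ⟪w, w⟫ = N := by rw [real_inner_self_eq_norm_sq, hww]
    have r2 : ⟪w, ρ⟫ = -(ξ - η) := by
      rw [hρ, inner_sub_right, inner_smul_right, hwi, r1, r1']; field_simp; ring
    have r3 : ⟪y, ρ⟫ = η - 2 * (ξ - η) / N * (P - (1 - B)) := by
      rw [hρ, inner_sub_right, inner_smul_right, r1', hη', hw, inner_sub_right, hyx, hY]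
    have r4 : ⟪ρ, ρ⟫ = 1 := by
      rw [hρ]
      simp only [inner_sub_left, inner_sub_right, inner_smul_left, inner_smul_right, hwi, r1, r1', hbb]
      simp only [conj_trivial]
      field_simp; ring
    have r5 : ⟪b i, ρ⟫ = 1 - 2 * (ξ - η) ^ 2 / N := by
      rw [hρ, inner_sub_right, inner_smul_right, hbb, r1']; ring
    have n1 : ‖A • b i - (t * B) • ρ‖ ^ 2 = A ^ 2 + t ^ 2 * B ^ 2 - 2 * t * A * B * (1 - 2 * (ξ - η) ^ 2 / N) := by
      rw [← real_inner_self_eq_norm_sq]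
      have r5' : ⟪ρ, b i⟫ = 1 - 2 * (ξ - η) ^ 2 / N := by rw [real_inner_comm, r5]
      simp only [inner_sub_left, inner_sub_right, inner_smul_left, inner_smul_right, hbb, r4, r5, r5']
      simp only [conj_trivial]
      ring
    have n2 : ‖A • b i‖ ^ 2 = A ^ 2 := by
      rw [← real_inner_self_eq_norm_sq]
      simp only [inner_smul_left, inner_smul_right, hbb, conj_trivial]; ring
    have n3 : ‖(t * B) • ρ‖ ^ 2 = t ^ 2 * B ^ 2 := by
      rw [← real_inner_self_eq_norm_sq]
      simp only [inner_smul_left, inner_smul_right, r4, conj_trivial]; ring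
    have r6 : ⟪b i, z⟫ = A / N * (ξ - η) + ξ := by
      rw [hz, ← hw, inner_add_right, inner_smul_right, r1', hξ]
    have r7 : ⟪b i, ζ⟫ = η - 2 * (P - (1 - B)) / N * (ξ - η) := by
      rw [hζ, ← hw, inner_sub_right, inner_smul_right, r1', hη]
    rw [← hw, n1, n2, n3] at h2
    simp only [inner_sub_right, inner_smul_right, map_smul, _root_.smul_apply, smul_eq_mul, hξ', r1, r2, r3] at h2
    rw [r6, r7, r1', ← hξ]
    refine h2.trans (le_of_eq ?_)
    have : P = (2 - A - B - N) / 2 := by linarith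
    rw [this]
    field_simp
    ring
  have S := Finset.sum_nonneg (fun i (_ : i ∈ Finset.univ) => key i)
  simp only [Finset.sum_add_distrib, Finset.sum_sub_distrib, ← Finset.mul_sum, b.sum_sq_inner_right,
    Finset.sum_const, nsmul_eq_mul, Finset.card_univ, ← hm] at S
  rw [trace_refl b H' w hww.symm hN0, hzz, hww, hxx, hζζ] at S
  have sx : A / u x * (∑ i, H (b i) (b i)) = 4 * (m - 2) * l * τ * (1 / A + (B - A) / (2 * N) - 1 / 2) := by
    have g := gx x
    rw [inner_sub_left, hX, hyx] at g
    have e1 : A / u x * (∑ i, H (b i) (b i)) = - 2 * (m - 2) * (D x / u x) := by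
      field_simp; linarith
    rw [e1, g]
    have : P = (2 - A - B - N) / 2 := by linarith
    rw [this]
    field_simp
    ring
  have sy : B / u y * (∑ i, H' (b i) (b i)) = - 4 * (m - 2) * l * τ * (1 / B + (A - B) / (2 * N) - 1 / 2) := by
    have g := gy y
    rw [inner_sub_left, hY, ← hP] at g
    have e1 : B / u y * (∑ i, H' (b i) (b i)) = - 2 * (m - 2) * (D' y / u y) := by
      field_simp; linarith
    rw [e1, g]
    have : P = (2 - A - B - N) / 2 := by linarith
    rw [this]
    field_simp
    ring
  have sx' : A ^ 2 / u x * (∑ i, H (b i) (b i)) = A * (4 * (m - 2) * l * τ * (1 / A + (B - A) / (2 * N) - 1 / 2)) := by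
    rw [← sx]; ring
  have sy' : t ^ 2 * B ^ 2 / u y * (∑ i, H' (b i) (b i)) = t ^ 2 * B * (- 4 * (m - 2) * l * τ * (1 / B + (A - B) / (2 * N) - 1 / 2)) := by
    rw [← sy]; ring
  rw [sx', sy'] at S
  have fin := final_id N A B τ t m hN0 hτ h ht'
  have eq : 0 ≤ -4 * l ^ 2 * (1 - t ^ 2) + l * (4 * (1 - t ^ 2) * (m - 1)) := by
    rw [← fin]
    refine S.trans (le_of_eq ?_)
    have q1 : (-4 * l ^ 2 * τ ^ 2 * (1 - t ^ 2) + l * (2 * τ * (1 - τ ^ 2) * (1 + t) ^ 2)) * (1 / τ ^ 2)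
        = -4 * l ^ 2 * (1 - t ^ 2) + l * (2 * (1 - τ ^ 2) * (1 + t) ^ 2 / τ) := by
      field_simp
    have q2 : A * (1 / A + (B - A) / (2 * N) - 1 / 2) = 1 + (A * B - A ^ 2) / (2 * N) - A / 2 := by
      field_simp
    have q3 : B * (1 / B + (A - B) / (2 * N) - 1 / 2) = 1 + (A * B - B ^ 2) / (2 * N) - B / 2 := by
      field_simp
    have q4 : (8 * t * A * B - 4 * (A + t * B) ^ 2) / N ^ 2 * N
        = (8 * t * A * B - 4 * (A + t * B) ^ 2) / N := by
      field_simp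
    rw [q1]
    linear_combination (l * τ) * q4 + (4 * (m - 2) * l * τ) * q2 + (4 * (m - 2) * l * τ * t ^ 2) * q3
  have : 0 < 4 * l * (1 - t ^ 2) * (l - (m - 1)) := by
    have : 0 < 1 - t ^ 2 := by nlinarith
    have : 0 < l - (m - 1) := by linarith
    positivity
  linarith

lemma hdist_nonneg (x y : E) : 0 ≤ hdist x y := by
  unfold hdist
  have := Real.arsinh_nonneg_iff.2 (Real.sqrt_nonneg (del x y))
  positivity

lemma harnack_log {ι : Type*} [Fintype ι] (b : OrthonormalBasis ι ℝ E) (u : E → ℝ)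
    (hc : ContinuousOn u (closedBall 0 1)) (hpos : ∀ x ∈ closedBall (0 : E) 1, 0 < u x)
    (cu : ∀ x ∈ ball (0 : E) 1, ContDiffAt ℝ 2 u x)
    (m l : ℝ) (hm : m = Fintype.card ι) (hl0 : 0 < l) (hl : m - 1 < l)
    (ha : ∀ x ∈ ball (0 : E) 1, (1 - ‖x‖ ^ 2) * (∑ i, fderiv ℝ (fderiv ℝ u) x (b i) (b i))
      + 2 * (m - 2) * fderiv ℝ u x x = 0) (x1 : E) (hx1 : x1 ∈ ball (0 : E) 1)
      (y1 : E) (hy1 : y1 ∈ ball (0 : E) 1) :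
      0 ≤ Real.log (u x1) - Real.log (u y1) + l * hdist x1 y1 := by
  by_contra! hneg
  haveI : FiniteDimensional ℝ E := Module.Finite.of_basis b.toBasis
  haveI : ProperSpace E := FiniteDimensional.proper ℝ E
  have hbc : ball (0 : E) 1 ⊆ closedBall 0 1 := ball_subset_closedBall
  have Lc : ContinuousOn (fun x => Real.log (u x)) (closedBall (0 : E) 1) :=
    hc.log fun x hx => (hpos x hx).ne'
  obtain ⟨K, hK⟩ := (isCompact_closedBall (0 : E) 1).exists_bound_of_continuousOn Lc
  have hu := (isCompact_closedBall (0 : E) 1).uniformContinuousOn_of_continuous Lc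
  rw [Metric.uniformContinuousOn_iff] at hu
  obtain ⟨η, hη, hu⟩ := hu _ (neg_pos.2 hneg)
  set F : E → E → ℝ := fun x y => Real.log (u x) - Real.log (u y) + l * hdist x y with hF
  set κ : ℝ := η ^ 2 / (Real.sinh (K / l) ^ 2 + 1) with hκ
  have hκ0 : 0 < κ := by positivity
  have small : ∀ x ∈ ball (0 : E) 1, ∀ y ∈ ball (0 : E) 1, F x y ≤ F x1 y1 →
      κ ≤ 1 - ‖x‖ ^ 2 ∧ κ ≤ 1 - ‖y‖ ^ 2 := by
    intro x hx y hy hxy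
    have hd := hdist_nonneg x y
    have hA := one_sub_pos hx
    have hB := one_sub_pos hy
    have h1 : η ≤ ‖x - y‖ := by
      by_contra! hlt
      have h2 := hu x (hbc hx) y (hbc hy) (by rwa [dist_eq_norm])
      rw [Real.dist_eq] at h2
      have h3 := neg_abs_le (Real.log (u x) - Real.log (u y))
      have h4 : 0 ≤ l * hdist x y := by positivity
      simp only [hF] at hxy
      linarith
    have h2 : hdist x y ≤ 2 * (K / l) := by
      have k1 := hK x (hbc hx)
      have k2 := hK y (hbc hy)
      rw [Real.norm_eq_abs] at k1 k2
      have k3 := neg_abs_le (Real.log (u x))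
      have k4 := le_abs_self (Real.log (u y))
      have : l * hdist x y ≤ 2 * K := by simp only [hF] at hxy; linarith
      rw [← mul_div_assoc, le_div_iff₀ hl0]; linarith
    have h3 : √(del x y) ≤ Real.sinh (K / l) := by
      rw [← Real.sinh_arsinh (√(del x y)), Real.sinh_le_sinh]
      unfold hdist at h2; linarith
    have hdel : 0 ≤ del x y := by unfold del; positivity
    have h4 : del x y ≤ Real.sinh (K / l) ^ 2 := by
      rw [← Real.sq_sqrt hdel]
      exact pow_le_pow_left₀ (Real.sqrt_nonneg _) h3 2
    unfold del at h4
    rw [div_le_iff₀ (by positivity)] at h4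
    have h5 : η ^ 2 ≤ ‖x - y‖ ^ 2 := pow_le_pow_left₀ hη.le h1 2
    have s0 := sq_nonneg (Real.sinh (K / l))
    have a1 : (1 - ‖x‖ ^ 2) * (1 - ‖y‖ ^ 2) ≤ 1 - ‖x‖ ^ 2 := by
      nlinarith [sq_nonneg ‖y‖]
    have a2 : (1 - ‖x‖ ^ 2) * (1 - ‖y‖ ^ 2) ≤ 1 - ‖y‖ ^ 2 := by
      nlinarith [sq_nonneg ‖x‖]
    constructor
    · rw [hκ, div_le_iff₀ (by positivity)]; nlinarith
    · rw [hκ, div_le_iff₀ (by positivity)]; nlinarith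
  set S : Set E := {x | κ ≤ 1 - ‖x‖ ^ 2} with hS
  have hSb : S ⊆ ball (0 : E) 1 := by
    intro x hx
    rw [mem_ball_zero_iff]
    have : κ ≤ 1 - ‖x‖ ^ 2 := hx
    nlinarith [norm_nonneg x]
  have hSc : IsCompact S := by
    refine (isCompact_closedBall (0 : E) 1).of_isClosed_subset ?_ (hSb.trans hbc)
    exact isClosed_le continuous_const (by fun_prop)
  obtain ⟨s1, s2⟩ := small x1 hx1 y1 hy1 le_rfl
  have hFc : ContinuousOn (fun p : E × E => F p.1 p.2) (S ×ˢ S) := by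
    have c1 : ContinuousOn (fun p : E × E => Real.log (u p.1)) (S ×ˢ S) :=
      Lc.comp continuousOn_fst fun p hp => hbc (hSb hp.1)
    have c2 : ContinuousOn (fun p : E × E => Real.log (u p.2)) (S ×ˢ S) :=
      Lc.comp continuousOn_snd fun p hp => hbc (hSb hp.2)
    have c3 : ContinuousOn (fun p : E × E => del p.1 p.2) (S ×ˢ S) := by
      unfold del
      refine ContinuousOn.div (by fun_prop) (by fun_prop) fun p hp => ?_
      exact (mul_pos (one_sub_pos (hSb hp.1)) (one_sub_pos (hSb hp.2))).ne'
    have c4 : ContinuousOn (fun p : E × E => hdist p.1 p.2) (S ×ˢ S) := by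
      unfold hdist
      exact continuousOn_const.mul (Real.continuous_arsinh.comp_continuousOn c3.sqrt)
    exact (c1.sub c2).add (continuousOn_const.mul c4)
  obtain ⟨⟨x, y⟩, ⟨hxS, hyS⟩, hmin⟩ := (hSc.prod hSc).exists_isMinOn ⟨(x1, y1), s1, s2⟩ hFc
  rw [isMinOn_iff] at hmin
  have hle : F x y ≤ F x1 y1 := hmin (x1, y1) ⟨s1, s2⟩
  have hx := hSb hxS
  have hy := hSb hyS
  have hxy : x ≠ y := by
    rintro rfl
    have := hdist_nonneg x x
    have h0 : 0 ≤ l * hdist x x := by positivity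
    simp only [hF] at hle
    linarith
  refine core b u x y hxy hx hy (hpos x (hbc hx)) (hpos y (hbc hy)) (cu x hx) (cu y hy) m l hm hl0 hl
    (ha x hx) (ha y hy) ?_
  intro x' hx' y' hy'
  by_cases h : F x' y' ≤ F x1 y1
  · obtain ⟨r1, r2⟩ := small x' hx' y' hy' h
    exact hmin (x', y') ⟨r1, r2⟩
  · exact hle.trans (not_le.1 h).le

lemma hdist_zero {z : E} (hz : z ∈ ball (0 : E) 1) :
    hdist z 0 = - Real.log ((1 - ‖z‖) / (1 + ‖z‖)) := by
  have hA := one_sub_pos hz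
  rw [mem_ball_zero_iff] at hz
  have hr := norm_nonneg z
  unfold hdist del
  simp only [sub_zero, norm_zero, ne_eq, OfNat.ofNat_ne_zero, not_false_eq_true, zero_pow, mul_one]
  have h1 : 1 + √(‖z‖ ^ 2 / (1 - ‖z‖ ^ 2)) ^ 2 = 1 / (1 - ‖z‖ ^ 2) := by
    rw [Real.sq_sqrt (by positivity)]; field_simp; ring
  rw [Real.arsinh, h1, Real.sqrt_div (by positivity), Real.sqrt_div (by positivity), Real.sqrt_sq hr,
    Real.sqrt_one, ← add_div]
  have h2 : (2 : ℝ) * Real.log ((‖z‖ + 1) / √(1 - ‖z‖ ^ 2))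
      = Real.log (((‖z‖ + 1) / √(1 - ‖z‖ ^ 2)) ^ 2) := by
    rw [Real.log_pow]; norm_num
  rw [h2, ← Real.log_inv, div_pow, Real.sq_sqrt hA.le]
  congr 1
  have : 1 - ‖z‖ ≠ 0 := by linarith
  have h3 : 1 + ‖z‖ ≠ 0 := by linarith
  rw [inv_div, div_eq_div_iff hA.ne' this]; ring

lemma harnack {ι : Type*} [Fintype ι] (b : OrthonormalBasis ι ℝ E) (u : E → ℝ)
    (hc : ContinuousOn u (closedBall 0 1)) (hpos : ∀ x ∈ closedBall (0 : E) 1, 0 < u x)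
    (cu : ∀ x ∈ ball (0 : E) 1, ContDiffAt ℝ 2 u x)
    (m : ℝ) (hm : m = Fintype.card ι) (k : ℕ) (hk : m - 1 = k)
    (ha : ∀ x ∈ ball (0 : E) 1, (1 - ‖x‖ ^ 2) * (∑ i, fderiv ℝ (fderiv ℝ u) x (b i) (b i))
      + 2 * (m - 2) * fderiv ℝ u x x = 0) (z : E) (hz : z ∈ ball (0 : E) 1) :
    ((1 - ‖z‖) / (1 + ‖z‖)) ^ k * u 0 ≤ u z := by
  have h0 : (0 : E) ∈ ball (0 : E) 1 := by simp
  have hd := hdist_nonneg z 0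
  have key : 0 ≤ Real.log (u z) - Real.log (u 0) + k * hdist z 0 := by
    refine le_of_forall_pos_le_add fun ε hε => ?_
    have h1 := harnack_log b u hc hpos cu m (k + ε / (hdist z 0 + 1)) hm (by positivity)
      (by rw [hk]; have : 0 < ε / (hdist z 0 + 1) := by positivity
          linarith) ha z hz 0 h0
    have h2 : ε / (hdist z 0 + 1) * hdist z 0 ≤ ε := by
      rw [div_mul_eq_mul_div, div_le_iff₀ (by positivity)]; nlinarith
    nlinarith
  rw [hdist_zero hz] at key
  have uz := hpos z (ball_subset_closedBall hz)
  have u0 := hpos 0 (ball_subset_closedBall h0)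
  rw [mem_ball_zero_iff] at hz
  have hr := norm_nonneg z
  have hq : 0 < (1 - ‖z‖) / (1 + ‖z‖) := div_pos (by linarith) (by linarith)
  rw [← Real.log_le_log_iff (by positivity) uz, Real.log_mul (by positivity) u0.ne', Real.log_pow]
  linarith

noncomputable def bas (n : ℕ) : OrthonormalBasis ((_ : Fin n) × Fin 2) ℝ (Cn n) :=
  Pi.orthonormalBasis (fun _ : Fin n => Complex.orthonormalBasisOneI)

lemma bas_zero (n : ℕ) (k : Fin n) : bas n ⟨k, 0⟩ = EuclideanSpace.single k (1 : ℂ) := by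
  simp [bas, Pi.orthonormalBasis_apply]

lemma bas_one (n : ℕ) (k : Fin n) : bas n ⟨k, 1⟩ = EuclideanSpace.single k Complex.I := by
  simp [bas, Pi.orthonormalBasis_apply]

lemma vec_eq (n : ℕ) (z : Cn n) : z = ∑ k, ((z k).re • EuclideanSpace.single k (1 : ℂ)
    + (z k).im • EuclideanSpace.single k Complex.I) := by
  ext j
  rw [WithLp.ofLp_sum, Finset.sum_apply, Finset.sum_eq_single j]
  · simp [Complex.re_add_im]
  · intro k _ hk
    simp [hk.symm]
  · simp

def HH (n : ℕ) (u : Cn n → ℝ) : Prop :=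
  (∀ x ∈ ball (0 : Cn n) 1, ContDiffAt ℝ 2 u x) ∧
  ∀ x ∈ ball (0 : Cn n) 1, (1 - ‖x‖ ^ 2) * (∑ i, fderiv ℝ (fderiv ℝ u) x (bas n i) (bas n i))
      + 2 * ((2 * n : ℝ) - 2) * fderiv ℝ u x x = 0

lemma fd2 {n : ℕ} {u : Cn n → ℝ} {x : Cn n} (h : ContDiffAt ℝ 2 u x) :
    DifferentiableAt ℝ (fderiv ℝ u) x :=
  (h.fderiv_right (m := 1) (by norm_num)).differentiableAt (by norm_num)

lemma fd1 {n : ℕ} {u : Cn n → ℝ} {x : Cn n} (h : ContDiffAt ℝ 2 u x) :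
    ∀ᶠ y in 𝓝 x, DifferentiableAt ℝ u y := by
  filter_upwards [h.eventually (by simp)] with y hy using hy.differentiableAt (by norm_num)

lemma HH.of_laplaceH {n : ℕ} {u : Cn n → ℝ}
    (h : ∀ x ∈ ball (0 : Cn n) 1, ContDiffAt ℝ 2 u x)
    (hl : ∀ x ∈ ball (0 : Cn n) 1, laplaceH n u x = 0) : HH n u := by
  refine ⟨h, fun x hx => ?_⟩
  have hA := one_sub_pos hx
  have h1 := hl x hx
  have hd := fd2 (h x hx)
  have e : ∀ v : Cn n, fderiv ℝ (fun w => fderiv ℝ u w v) x v = fderiv ℝ (fderiv ℝ u) x v v := by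
    intro v
    rw [fderiv_clm_apply hd (differentiableAt_const v)]
    simp
  have e2 : ∑ k, ((x k).re * fderiv ℝ u x (EuclideanSpace.single k 1) +
            (x k).im * fderiv ℝ u x (EuclideanSpace.single k Complex.I)) = fderiv ℝ u x x := by
    conv_rhs => rw [vec_eq n x]
    rw [map_sum]
    refine Finset.sum_congr rfl fun k _ => ?_
    rw [map_add, map_smul, map_smul, smul_eq_mul, smul_eq_mul, ← vec_eq]
  unfold laplaceH at h1
  simp only [e] at h1
  rw [e2] at h1
  rw [Fintype.sum_sigma]
  simp only [Fin.sum_univ_two, bas_zero, bas_one]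
  have : (1 - ‖x‖ ^ 2) * ((1 - ‖x‖ ^ 2) * (∑ k, (fderiv ℝ (fderiv ℝ u) x (EuclideanSpace.single k 1) (EuclideanSpace.single k 1) + fderiv ℝ (fderiv ℝ u) x (EuclideanSpace.single k Complex.I) (EuclideanSpace.single k Complex.I)))
      + 2 * ((2 * n : ℝ) - 2) * fderiv ℝ u x x) = 0 := by
    rw [← h1]; ring
  exact (mul_eq_zero.1 this).resolve_left hA.ne'

lemma HH.add {n : ℕ} {u v : Cn n → ℝ} (hu : HH n u) (hv : HH n v) : HH n (fun x => u x + v x) := by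
  refine ⟨fun x hx => (hu.1 x hx).add (hv.1 x hx), fun x hx => ?_⟩
  have cu := hu.1 x hx
  have cv := hv.1 x hx
  have e : fderiv ℝ (fun x => u x + v x) =ᶠ[𝓝 x] fun y => fderiv ℝ u y + fderiv ℝ v y := by
    filter_upwards [fd1 cu, fd1 cv] with y h1 h2 using fderiv_fun_add h1 h2
  rw [e.fderiv_eq, e.self_of_nhds, fderiv_fun_add (fd2 cu) (fd2 cv)]
  simp only [_root_.add_apply, Finset.sum_add_distrib]
  linear_combination hu.2 x hx + hv.2 x hx

lemma HH.const_mul {n : ℕ} {u : Cn n → ℝ} (hu : HH n u) (c : ℝ) : HH n (fun x => c * u x) := by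
  refine ⟨fun x hx => contDiffAt_const.mul (hu.1 x hx), fun x hx => ?_⟩
  have cu := hu.1 x hx
  have e : fderiv ℝ (fun x => c * u x) =ᶠ[𝓝 x] fun y => c • fderiv ℝ u y := by
    filter_upwards [fd1 cu] with y h1 using fderiv_const_mul h1 c
  rw [e.fderiv_eq, e.self_of_nhds, fderiv_fun_const_smul (fd2 cu)]
  simp only [_root_.smul_apply, smul_eq_mul, ← Finset.mul_sum]
  linear_combination c * hu.2 x hx

lemma HH.const (n : ℕ) (c : ℝ) : HH n (fun _ => c) := by
  refine ⟨fun x hx => contDiffAt_const, fun x hx => ?_⟩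
  have : fderiv ℝ (fun _ : Cn n => c) = fun _ => 0 := by ext1 y; simp
  rw [this]; simp

lemma HH.sum {n : ℕ} {ι : Type*} (s : Finset ι) (u : ι → Cn n → ℝ) (h : ∀ i, HH n (u i)) :
    HH n (fun x => ∑ i ∈ s, u i x) := by
  classical
  induction s using Finset.induction_on with
  | empty => simpa using HH.const n 0
  | insert a s ha ih =>
    simp only [Finset.sum_insert ha]
    exact (h a).add ih

lemma HH.inner {n : ℕ} {f : Cn n → Cn n} (hh : ∀ j : Fin n, IsHHarmonic n (fun w => f w j))
    (v : Cn n) : HH n (fun w => inner ℝ v (f w)) := by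
  have hc : ∀ j, ∀ x ∈ ball (0 : Cn n) 1, ContDiffAt ℝ 2 (fun w => f w j) x := fun j x hx =>
    (hh j).1.contDiffAt (isOpen_ball.mem_nhds hx)
  have hre : ∀ j, HH n (fun w => (f w j).re) := fun j =>
    HH.of_laplaceH (fun x hx => Complex.reCLM.contDiff.contDiffAt.comp x (hc j x hx))
      fun x hx => ((hh j).2 x hx).1
  have him : ∀ j, HH n (fun w => (f w j).im) := fun j =>
    HH.of_laplaceH (fun x hx => Complex.imCLM.contDiff.contDiffAt.comp x (hc j x hx))
      fun x hx => ((hh j).2 x hx).2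
  have := HH.sum Finset.univ _ fun j => ((hre j).const_mul (v j).re).add ((him j).const_mul (v j).im)
  convert this using 2 with w
  rw [PiLp.inner_apply]
  refine Finset.sum_congr rfl fun j _ => ?_
  rw [Complex.inner]
  simp
  ring

end Helpers

/-- Let `f : Bⁿ → ℂⁿ` be continuous on the closed unit ball,
`h`-harmonic in each component, with `|f(z)| ≤ M` on `Bⁿ`. Then for every `z ∈ Bⁿ`,
`|f(z) − ((1−|z|)/(1+|z|))^{2n−1} f(0)| ≤ M (1 − ((1−|z|)/(1+|z|))^{2n−1})`. -/
theorem schwarzPick_type_value (n : ℕ) (hn : 1 ≤ n) (M : ℝ) (hM : 0 < M)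
    (f : Cn n → Cn n) (hcont : ContinuousOn f (closedBall 0 1))
    (hh : ∀ j : Fin n, IsHHarmonic n (fun w => f w j))
    (hbd : ∀ z ∈ ball (0 : Cn n) 1, ‖f z‖ ≤ M)
    (z : Cn n) (hz : z ∈ ball (0 : Cn n) 1) :
    ‖f z - (((1 - ‖z‖) / (1 + ‖z‖)) ^ (2 * n - 1) : ℝ) • f 0‖ ≤
      M * (1 - ((1 - ‖z‖) / (1 + ‖z‖)) ^ (2 * n - 1)) := by
  obtain ⟨c, hc⟩ : ∃ c : ℝ, c = ((1 - ‖z‖) / (1 + ‖z‖)) ^ (2 * n - 1) := ⟨_, rfl⟩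
  have hz' := mem_ball_zero_iff.1 hz
  have hr := norm_nonneg z
  have hc0 : 0 ≤ c := by
    rw [hc]; exact pow_nonneg (div_nonneg (by linarith) (by linarith)) _
  have hc1 : c ≤ 1 := by
    rw [hc]
    refine pow_le_one₀ (div_nonneg (by linarith) (by linarith)) ?_
    rw [div_le_one (by linarith)]; linarith
  have hcl : ∀ w ∈ closedBall (0 : Cn n) 1, ‖f w‖ ≤ M := by
    intro w hw
    have e := closure_ball (0 : Cn n) (one_ne_zero (α := ℝ))
    exact le_on_closure hbd (by rw [e]; exact hcont.norm) continuousOn_const (by rw [e]; exact hw)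
  rw [← hc]
  obtain ⟨v, hv⟩ : ∃ v, v = f z - c • f 0 := ⟨_, rfl⟩
  rw [← hv]
  rcases eq_or_ne v 0 with h0 | h0
  · rw [h0, norm_zero]
    exact mul_nonneg hM.le (by linarith)
  have hvp : 0 < ‖v‖ := norm_pos_iff.2 h0
  refine le_of_forall_pos_le_add fun ε hε => ?_
  have hH : HH n (fun w => (M + ε) * ‖v‖ + (-1) * inner ℝ v (f w)) :=
    (HH.const n _).add ((HH.inner hh v).const_mul (-1))
  have key := harnack (bas n) _ (m := 2 * n) (k := 2 * n - 1)
    (hc := by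
      have : ContinuousOn (fun w => (inner ℝ v (f w) : ℝ)) (closedBall (0 : Cn n) 1) :=
        continuousOn_const.inner hcont
      exact continuousOn_const.add (continuousOn_const.mul this))
    (hpos := by
      intro w hw
      have h1 := real_inner_le_norm v (f w)
      have h2 := mul_le_mul_of_nonneg_left (hcl w hw) hvp.le
      have h3 := mul_pos hε hvp
      show 0 < (M + ε) * ‖v‖ + (-1) * inner ℝ v (f w)
      linarith)
    (cu := hH.1) (hm := by simp [mul_comm]) (hk := by
      rw [Nat.cast_sub (by omega)]; push_cast; ring) (ha := hH.2) (z := z) (hz := hz)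
  simp only [← hc] at key
  have hvv : (inner ℝ v (f z) : ℝ) - c * inner ℝ v (f 0) = ‖v‖ ^ 2 := by
    rw [← real_inner_self_eq_norm_sq]
    conv_rhs => rw [show (inner ℝ v v : ℝ) = inner ℝ v (f z - c • f 0) by rw [← hv]]
    rw [inner_sub_right, inner_smul_right]
  have h5 : ‖v‖ * ‖v‖ ≤ ((M + ε) * (1 - c)) * ‖v‖ := by nlinarith
  have h6 := le_of_mul_le_mul_right h5 hvp
  nlinarith
end
end

section
/- Let r > 0 and let A(z) = (a_{ij}(z)) be an n×n matrix-valued function on the ball B^n(r) ⊂ C^n, each entry being continuous on the closed ball B̄^n(r) and hyperbolic-harmonic (after rescaling to the unit ball, i.e. z ↦ a_{ij}(rz) is h-harmonic on B^n). If A(0) = 0 and |A(z)| ≤ M on B^n(r), where |A| denotes the operator norm, then for all z ∈ B^n(r): |A(z)| ≤ M [ 1 − ((r−|z|)/(r+|z|))^{2n−1} ]. -/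
open MeasureTheory Metric Complex

noncomputable section

/-- The operator norm `|A| = max{|Aθ| : θ ∈ ∂Bⁿ}` of an `n×n` complex matrix, with respect to
the Euclidean norm. -/
noncomputable def matOpNorm (n : ℕ) (A : Matrix (Fin n) (Fin n) ℂ) : ℝ :=
  sSup ((fun θ : Cn n => euclNorm n (A.mulVec fun k => θ k)) '' sphere (0 : Cn n) 1)
section Harnack
set_option linter.unusedSectionVars false
open Topology Filter

lemma second_deriv_nonpos {g g' : ℝ → ℝ} {d : ℝ}
    (h1 : ∀ᶠ t in 𝓝 (0:ℝ), HasDerivAt g (g' t) t) (h2 : HasDerivAt g' d 0)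
    (hm : IsLocalMax g 0) : d ≤ 0 := by
  by_contra hd
  push Not at hd
  have hg0 : HasDerivAt g (g' 0) 0 := h1.self_of_nhds
  have h0 : g' 0 = 0 := hm.hasDerivAt_eq_zero hg0
  have he : deriv g =ᶠ[𝓝 0] g' := h1.mono fun t ht => ht.deriv
  have hdd : deriv (deriv g) 0 = d := by rw [he.deriv_eq, h2.deriv]
  have hmin : IsLocalMin g 0 := isLocalMin_of_deriv_deriv_pos (by rw [hdd]; exact hd)
    (by rw [hg0.deriv, h0]) hg0.continuousAt
  have hc : g =ᶠ[𝓝 0] fun _ => g 0 := by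
    filter_upwards [hm, hmin] with t a b using le_antisymm a b
  have hz : deriv g =ᶠ[𝓝 0] deriv (fun _ => g 0) := hc.deriv
  have : deriv (deriv g) 0 = 0 := by
    rw [hz.deriv_eq]; simp
  linarith

variable {ι E : Type*} [Fintype ι] [NormedAddCommGroup E] [InnerProductSpace ℝ E]

def HarmSub (e : ι → E) (j : ℕ) (x : E) : Submodule ℝ (E → ℝ) where
  carrier := {u | ∃ (d2 : ι → ℝ) (d1 : ℝ),
    (∀ i, ∃ g' : ℝ → ℝ, (∀ᶠ t in 𝓝 (0:ℝ), HasDerivAt (fun s : ℝ => u (x + s • e i)) (g' t) t) ∧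
      HasDerivAt g' (d2 i) 0) ∧
    HasDerivAt (fun s : ℝ => u (x + s • x)) d1 0 ∧
    (1 - ‖x‖ ^ 2) * ∑ i, d2 i + 2 * j * d1 = 0}
  zero_mem' := by
    refine ⟨0, 0, fun i => ⟨0, Eventually.of_forall fun t => ?_, ?_⟩, ?_, by simp⟩
    · exact hasDerivAt_const _ _
    · exact hasDerivAt_const _ _
    · exact hasDerivAt_const _ _
  add_mem' := by
    rintro u v ⟨d2, d1, h, h', h''⟩ ⟨c2, c1, k, k', k''⟩
    refine ⟨d2 + c2, d1 + c1, fun i => ?_, h'.add k', ?_⟩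
    · obtain ⟨g, hg, hg'⟩ := h i
      obtain ⟨f, hf, hf'⟩ := k i
      refine ⟨g + f, ?_, hg'.add hf'⟩
      filter_upwards [hg, hf] with t a b using a.add b
    · simp only [Pi.add_apply, Finset.sum_add_distrib]
      linear_combination h'' + k''
  smul_mem' := by
    rintro c u ⟨d2, d1, h, h', h''⟩
    refine ⟨c • d2, c * d1, fun i => ?_, h'.const_mul c, ?_⟩
    · obtain ⟨g, hg, hg'⟩ := h i
      refine ⟨fun t => c * g t, ?_, hg'.const_mul c⟩
      filter_upwards [hg] with t a using a.const_mul c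
    · simp only [Pi.smul_apply, smul_eq_mul, ← Finset.mul_sum]
      linear_combination c * h''

lemma const_mem_HarmSub (e : ι → E) (j : ℕ) (x : E) (c : ℝ) : (fun _ => c) ∈ HarmSub e j x := by
  refine ⟨0, 0, fun i => ⟨0, Eventually.of_forall fun t => ?_, ?_⟩, ?_, by simp⟩
  · exact hasDerivAt_const _ _
  · exact hasDerivAt_const _ _
  · exact hasDerivAt_const _ _

lemma normsq_line (x v : E) (t : ℝ) :
    ‖x + t • v‖ ^ 2 = ‖x‖ ^ 2 + 2 * t * inner ℝ x v + t ^ 2 * ‖v‖ ^ 2 := by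
  rw [norm_add_sq_real, norm_smul, inner_smul_right, mul_pow, Real.norm_eq_abs, sq_abs]; ring

lemma hasDerivAt_normsq (x v : E) (t : ℝ) :
    HasDerivAt (fun s : ℝ => ‖x + s • v‖ ^ 2) (2 * inner ℝ x v + 2 * t * ‖v‖ ^ 2) t := by
  have : (fun s : ℝ => ‖x + s • v‖ ^ 2) =
      fun t => ‖x‖ ^ 2 + 2 * t * inner ℝ x v + t ^ 2 * ‖v‖ ^ 2 := by
    ext t; exact normsq_line x v t
  rw [this]
  have := ((((hasDerivAt_id t).const_mul 2).mul_const (inner ℝ x v)).const_add (‖x‖ ^ 2)).add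
    (((hasDerivAt_id t).pow 2).mul_const (‖v‖ ^ 2))
  refine HasDerivAt.congr_deriv this ?_
  simp

lemma max_principle [FiniteDimensional ℝ E] [Nonempty ι] (e : ι → E) (he : ∀ i, ‖e i‖ = 1) (j : ℕ)
    {ρ : ℝ} (hρ1 : ρ ≤ 1) {u : E → ℝ} {δ : ℝ}
    (hc : ContinuousOn u (closedBall 0 ρ)) (hh : ∀ x ∈ ball (0:E) ρ, u ∈ HarmSub e j x)
    (hb : ∀ x ∈ sphere (0:E) ρ, u x ≤ δ) : ∀ x ∈ closedBall (0:E) ρ, u x ≤ δ := by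
  intro x0 hx0
  by_contra hcon
  push Not at hcon
  have hρ0 : 0 ≤ ρ := by
    have := mem_closedBall_zero_iff.1 hx0
    exact (norm_nonneg _).trans this
  obtain ⟨ε, hε, hεx⟩ : ∃ ε > 0, δ + ε < u x0 := ⟨(u x0 - δ) / 2, by linarith, by linarith⟩
  have hvc : ContinuousOn (fun x => u x + ε * ‖x‖ ^ 2) (closedBall 0 ρ) := by fun_prop
  obtain ⟨p, hp, hmax⟩ := (isCompact_closedBall (0:E) ρ).exists_isMaxOn ⟨x0, hx0⟩ hvc
  have hpb : p ∈ ball (0:E) ρ := by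
    rw [mem_ball_zero_iff]
    refine lt_of_le_of_ne (mem_closedBall_zero_iff.1 hp) fun hne => ?_
    have h1 := hb p (mem_sphere_zero_iff_norm.2 hne)
    have h2 : u x0 + ε * ‖x0‖ ^ 2 ≤ u p + ε * ‖p‖ ^ 2 := hmax hx0
    rw [hne] at h2
    have h3 : ρ ^ 2 ≤ 1 := by nlinarith
    have h4 : 0 ≤ ε * ‖x0‖ ^ 2 := by positivity
    nlinarith
  have hp1 : ‖p‖ < 1 := (mem_ball_zero_iff.1 hpb).trans_le hρ1
  have hloc : IsLocalMax (fun x => u x + ε * ‖x‖ ^ 2) p :=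
    hmax.isLocalMax (Filter.mem_of_superset (isOpen_ball.mem_nhds hpb) ball_subset_closedBall)
  have hline : ∀ v : E, IsLocalMax (fun t : ℝ => u (p + t • v) + ε * ‖p + t • v‖ ^ 2) 0 := by
    intro v
    have hcont : ContinuousAt (fun t : ℝ => p + t • v) 0 := by fun_prop
    have : Tendsto (fun t : ℝ => p + t • v) (𝓝 0) (𝓝 p) := by simpa using hcont.tendsto
    have h := this.eventually hloc
    simpa [IsLocalMax, IsMaxFilter] using h
  obtain ⟨d2, d1, h2, h1, heq⟩ := hh p hpb
  have hd1 : d1 + ε * (2 * ‖p‖ ^ 2) = 0 := by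
    have := (hline p).hasDerivAt_eq_zero (h1.add ((hasDerivAt_normsq p p 0).const_mul ε))
    simpa using this
  have hd2 : ∀ i, d2 i ≤ - (2 * ε) := by
    intro i
    obtain ⟨g, hg, hg'⟩ := h2 i
    have := second_deriv_nonpos (g' := fun t => g t + ε * (2 * inner ℝ p (e i) + 2 * t * ‖e i‖ ^ 2))
      (d := d2 i + ε * 2) ?_ ?_ (hline (e i))
    · linarith
    · filter_upwards [hg] with t ht using ht.add ((hasDerivAt_normsq p (e i) t).const_mul ε)
    · refine hg'.add (HasDerivAt.const_mul ε ?_)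
      have := (((hasDerivAt_id (0:ℝ)).const_mul 2)).const_add (2 * inner ℝ p (e i))
      simpa [he i] using this
  have hs : ∑ i, d2 i < 0 := by
    refine Finset.sum_neg (fun i _ => (hd2 i).trans_lt (by linarith)) Finset.univ_nonempty
  have ha : 0 < 1 - ‖p‖ ^ 2 := by nlinarith [norm_nonneg p]
  have : (1 - ‖p‖ ^ 2) * ∑ i, d2 i < 0 := mul_neg_of_pos_of_neg ha hs
  have hd1' : d1 ≤ 0 := by nlinarith [sq_nonneg ‖p‖]
  have : 2 * (j:ℝ) * d1 ≤ 0 := mul_nonpos_of_nonneg_of_nonpos (by positivity) hd1'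
  linarith

/-- The hyperbolic Poisson kernel. -/
def PK (j : ℕ) (ζ x : E) : ℝ := ((1 - ‖x‖ ^ 2) / ‖x - ζ‖ ^ 2) ^ (j + 1)

lemma PK_mem (e : ι → E) (he : ∀ i, ‖e i‖ = 1) (j : ℕ) (hcard : Fintype.card ι = j + 2)
    (hpars : ∀ x y : E, ∑ i, inner ℝ x (e i) * inner ℝ y (e i) = inner ℝ x y)
    {ζ x : E} (hζ : ‖ζ‖ = 1) (hx : ‖x‖ < 1) : PK j ζ ∈ HarmSub e j x := by
  have hne : ∀ y : E, ‖y‖ < 1 → ‖y - ζ‖ ^ 2 ≠ 0 := by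
    intro y hy h
    have : y - ζ = 0 := by simpa using h
    rw [sub_eq_zero.1 this, hζ] at hy
    exact lt_irrefl _ hy
  have hq : ∀ (v : E) (t : ℝ), ‖x + t • v‖ < 1 →
      HasDerivAt (fun s : ℝ => (1 - ‖x + s • v‖ ^ 2) / ‖x + s • v - ζ‖ ^ 2)
      ((-(2 * inner ℝ x v + 2 * t * ‖v‖ ^ 2) * ‖x + t • v - ζ‖ ^ 2 -
        (1 - ‖x + t • v‖ ^ 2) * (2 * inner ℝ (x - ζ) v + 2 * t * ‖v‖ ^ 2)) /
        (‖x + t • v - ζ‖ ^ 2) ^ 2) t := by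
    intro v t ht
    have hb := hasDerivAt_normsq (x - ζ) v t
    have e1 : (fun s : ℝ => ‖x - ζ + s • v‖ ^ 2) = fun s => ‖x + s • v - ζ‖ ^ 2 := by
      ext s; congr 2; abel
    rw [e1] at hb
    exact ((hasDerivAt_normsq x v t).const_sub 1).div hb (hne _ ht)
  have hev : ∀ v : E, ∀ᶠ t in 𝓝 (0:ℝ), ‖x + t • v‖ < 1 := by
    intro v
    have hcont : ContinuousAt (fun t : ℝ => ‖x + t • v‖) 0 := by fun_prop
    exact hcont.eventually_lt_const (by simpa using hx)
  set a := 1 - ‖x‖ ^ 2 with ha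
  set b := ‖x - ζ‖ ^ 2 with hb
  have ha0 : 0 < a := by rw [ha]; nlinarith [norm_nonneg x]
  have hb0 : b ≠ 0 := hne x hx
  let q1 : E → ℝ := fun v => (-(2 * inner ℝ x v) * b - a * (2 * inner ℝ (x - ζ) v)) / b ^ 2
  let q2 : ι → ℝ := fun i => (-2 * b - 2 * a) / b ^ 2 -
    4 * inner ℝ (x - ζ) (e i) * (-(2 * inner ℝ x (e i)) * b - a * (2 * inner ℝ (x - ζ) (e i))) / b ^ 3
  refine ⟨fun i => (j + 1) * (j * (a / b) ^ (j - 1) * q1 (e i) ^ 2 + (a / b) ^ j * q2 i),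
    (j + 1) * (a / b) ^ j * q1 x, fun i => ⟨fun t => (j + 1) *
      ((1 - ‖x + t • e i‖ ^ 2) / ‖x + t • e i - ζ‖ ^ 2) ^ j *
      ((-(2 * inner ℝ x (e i) + 2 * t * ‖e i‖ ^ 2) * ‖x + t • e i - ζ‖ ^ 2 -
        (1 - ‖x + t • e i‖ ^ 2) * (2 * inner ℝ (x - ζ) (e i) + 2 * t * ‖e i‖ ^ 2)) /
        (‖x + t • e i - ζ‖ ^ 2) ^ 2), ?_, ?_⟩, ?_, ?_⟩
  · filter_upwards [hev (e i)] with t ht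
    have := (hq (e i) t ht).pow (j + 1)
    refine HasDerivAt.congr_deriv this ?_
    push_cast
    simp
  · have hx0 : ‖x + (0:ℝ) • e i‖ < 1 := by simpa using hx
    have hb' := hasDerivAt_normsq (x - ζ) (e i) 0
    have e1 : (fun s : ℝ => ‖x - ζ + s • e i‖ ^ 2) = fun s => ‖x + s • e i - ζ‖ ^ 2 := by
      ext s; congr 2; abel
    rw [e1] at hb'
    have ha' := (hasDerivAt_normsq x (e i) 0).const_sub 1
    have hl : ∀ c : ℝ, HasDerivAt (fun t : ℝ => 2 * c + 2 * t * ‖e i‖ ^ 2) 2 0 := by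
      intro c
      have := (((hasDerivAt_id (0:ℝ)).const_mul 2)).const_add (2 * c)
      simpa [he i] using this
    have hnum := ((hl (inner ℝ x (e i))).neg.mul hb').sub (ha'.mul (hl (inner ℝ (x - ζ) (e i))))
    have hden := hb'.pow 2
    have hfrac := hnum.div hden (pow_ne_zero 2 (hne _ hx0))
    have := (((hq (e i) 0 hx0).pow j).const_mul ((j:ℝ) + 1)).mul hfrac
    refine HasDerivAt.congr_deriv this ?_
    simp only [Pi.pow_apply, Pi.mul_apply, Pi.sub_apply, Pi.neg_apply, Pi.div_apply, zero_smul, add_zero, mul_zero, zero_mul, ← ha, ← hb, q1, q2]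
    field_simp
    ring
  · have := (hq x 0 (by simpa using hx)).pow (j + 1)
    refine HasDerivAt.congr_deriv this ?_
    push_cast
    simp [q1, ← ha, ← hb]
  · have s1 : ∑ i, inner ℝ x (e i) * inner ℝ x (e i) = 1 - a := by
      rw [hpars, real_inner_self_eq_norm_sq]; ring
    have s2 : ∑ i, inner ℝ (x - ζ) (e i) * inner ℝ (x - ζ) (e i) = b := by
      rw [hpars, real_inner_self_eq_norm_sq]
    have hxz : inner ℝ x (x - ζ) = (b - a) / 2 := by
      have h1 : b = ‖x‖ ^ 2 - 2 * inner ℝ x ζ + ‖ζ‖ ^ 2 := norm_sub_sq_real x ζ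
      rw [inner_sub_right, real_inner_self_eq_norm_sq]
      rw [hζ] at h1
      linarith
    have s3 : ∑ i, inner ℝ x (e i) * inner ℝ (x - ζ) (e i) = (b - a) / 2 := by
      rw [hpars, hxz]
    have hQ1 : ∑ i, q1 (e i) ^ 2 = 4 / b ^ 2 := by
      have : ∀ i, q1 (e i) ^ 2 = (4 / b ^ 2) * (inner ℝ x (e i) * inner ℝ x (e i)) +
          (8 * a / b ^ 3) * (inner ℝ x (e i) * inner ℝ (x - ζ) (e i)) +
          (4 * a ^ 2 / b ^ 4) * (inner ℝ (x - ζ) (e i) * inner ℝ (x - ζ) (e i)) := by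
        intro i; simp only [q1]; field_simp; ring
      simp only [this, Finset.sum_add_distrib, ← Finset.mul_sum, s1, s2, s3]
      field_simp; ring
    have hQ2 : ∑ i, q2 i = - 2 * j * (a + b) / b ^ 2 := by
      have : ∀ i, q2 i = (-2 * b - 2 * a) / b ^ 2 +
          (8 / b ^ 2) * (inner ℝ x (e i) * inner ℝ (x - ζ) (e i)) +
          (8 * a / b ^ 3) * (inner ℝ (x - ζ) (e i) * inner ℝ (x - ζ) (e i)) := by
        intro i; simp only [q2]; field_simp; ring
      simp only [this, Finset.sum_add_distrib, ← Finset.mul_sum, s2, s3, Finset.sum_const,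
        Finset.card_univ, hcard, nsmul_eq_mul]
      push_cast
      field_simp; ring
    have hQ3 : q1 x = (-2 * b + a * b + a ^ 2) / b ^ 2 := by
      simp only [q1]
      rw [real_inner_comm x (x - ζ), hxz, real_inner_self_eq_norm_sq]
      rw [show ‖x‖ ^ 2 = 1 - a by rw [ha]; ring]
      field_simp; ring
    have hj : (j:ℝ) * (a / b) ^ (j - 1) * (a / b) = j * (a / b) ^ j := by
      cases j with
      | zero => simp
      | succ k => simp [pow_succ]; ring
    rw [← Finset.mul_sum, Finset.sum_add_distrib, ← Finset.mul_sum, ← Finset.mul_sum, hQ1, hQ2, hQ3]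
    have hj' : (j:ℝ) * (a / b) ^ (j - 1) * a = j * (a / b) ^ j * b := by
      rw [← hj]; field_simp
    have : a * ((j + 1) * (j * (a / b) ^ (j - 1) * (4 / b ^ 2) +
      (a / b) ^ j * (-2 * j * (a + b) / b ^ 2))) = (j + 1) * ((j * (a / b) ^ (j - 1) * a) * (4 / b ^ 2) +
      a * (a / b) ^ j * (-2 * j * (a + b) / b ^ 2)) := by ring
    rw [this, hj']
    generalize (a / b) ^ j = Q
    field_simp
    ring
def HS (e : ι → E) (j : ℕ) (ρ : ℝ) : Submodule ℝ C(closedBall (0:E) ρ, ℝ) where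
  carrier := {f | ∃ u : E → ℝ, (∀ x ∈ ball (0:E) ρ, u ∈ HarmSub e j x) ∧ ∀ x, f x = u x}
  zero_mem' := ⟨0, fun x _ => Submodule.zero_mem _, fun x => rfl⟩
  add_mem' := by
    rintro f g ⟨u, hu, hu'⟩ ⟨v, hv, hv'⟩
    exact ⟨u + v, fun x hx => Submodule.add_mem _ (hu x hx) (hv x hx), fun x => by simp [hu', hv']⟩
  smul_mem' := by
    rintro c f ⟨u, hu, hu'⟩
    exact ⟨c • u, fun x hx => Submodule.smul_mem _ c (hu x hx), fun x => by simp [hu']⟩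

lemma HS_le [FiniteDimensional ℝ E] [Nonempty ι] {e : ι → E} (he : ∀ i, ‖e i‖ = 1) {j : ℕ}
    {ρ : ℝ} (hρ1 : ρ ≤ 1) {f : C(closedBall (0:E) ρ, ℝ)} (hf : f ∈ HS e j ρ) {δ : ℝ}
    (hb : ∀ x : closedBall (0:E) ρ, ‖(x:E)‖ = ρ → f x ≤ δ) (x) : f x ≤ δ := by
  obtain ⟨u, hu, hu'⟩ := hf
  rw [hu']
  refine max_principle e he j hρ1 (u := u) ?_ hu ?_ x x.2
  · rw [continuousOn_iff_continuous_domRestrict]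
    have : (closedBall (0:E) ρ).domRestrict u = f := by ext x; simp [hu']
    rw [this]; exact f.continuous
  · intro y hy
    have := hb ⟨y, sphere_subset_closedBall hy⟩ (by simpa using hy)
    rwa [hu'] at this

lemma HS_closure_le [FiniteDimensional ℝ E] [Nonempty ι] {e : ι → E} (he : ∀ i, ‖e i‖ = 1) {j : ℕ}
    {ρ : ℝ} (hρ1 : ρ ≤ 1) {f : C(closedBall (0:E) ρ, ℝ)} (hf : f ∈ (HS e j ρ).topologicalClosure)
    {δ : ℝ} (hb : ∀ x : closedBall (0:E) ρ, ‖(x:E)‖ = ρ → f x ≤ δ) (x) : f x ≤ δ := by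
  refine le_of_forall_pos_le_add fun ε hε => ?_
  have hf' : f ∈ closure (HS e j ρ : Set C(closedBall (0:E) ρ, ℝ)) := hf
  obtain ⟨g, hg, hfg⟩ := Metric.mem_closure_iff.1 hf' (ε / 2) (by positivity)
  have hd : ∀ y, |f y - g y| ≤ ε / 2 := fun y => by
    have := (ContinuousMap.dist_apply_le_dist (f := f) (g := g) y).trans hfg.le
    rwa [Real.dist_eq] at this
  have := HS_le he hρ1 hg (δ := δ + ε / 2) (fun y hy => by
    have h1 := abs_le.1 (hd y); have h2 := hb y hy; linarith [h1.1]) x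
  have h1 := abs_le.1 (hd x)
  linarith [h1.2]

lemma HS_closure_abs_le [FiniteDimensional ℝ E] [Nonempty ι] {e : ι → E} (he : ∀ i, ‖e i‖ = 1) {j : ℕ}
    {ρ : ℝ} (hρ1 : ρ ≤ 1) {f : C(closedBall (0:E) ρ, ℝ)} (hf : f ∈ (HS e j ρ).topologicalClosure)
    {δ : ℝ} (hb : ∀ x : closedBall (0:E) ρ, ‖(x:E)‖ = ρ → |f x| ≤ δ) (x) : |f x| ≤ δ := by
  rw [abs_le]
  constructor
  · have := HS_closure_le he hρ1 (Submodule.neg_mem _ hf) (δ := δ) (fun y hy => by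
      have := (abs_le.1 (hb y hy)).1
      simp; linarith) x
    simp at this
    linarith
  · exact HS_closure_le he hρ1 hf (fun y hy => (abs_le.1 (hb y hy)).2) x

lemma exists_sphere_measure [FiniteDimensional ℝ E] [Nontrivial E] [MeasurableSpace E] [BorelSpace E] :
    ∃ σ : Measure E, IsProbabilityMeasure σ ∧ (∀ᵐ y ∂σ, ‖y‖ = 1) ∧
      ∀ T : E ≃ₗᵢ[ℝ] E, MeasurePreserving T σ σ := by
  let S : Set E := ball 0 1 \ {0}
  have hSm : MeasurableSet S := measurableSet_ball.diff (measurableSet_singleton _)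
  have hSv : volume S = volume (ball (0:E) 1) := measure_sdiff_null (by simp)
  have h0 : volume S ≠ 0 := by rw [hSv]; exact (measure_ball_pos _ _ one_pos).ne'
  have ht : volume S ≠ ⊤ := by rw [hSv]; exact measure_ball_lt_top.ne
  have hν : Measurable (fun y : E => ‖y‖⁻¹ • y) := by fun_prop
  let μ : Measure E := (volume S)⁻¹ • volume.restrict S
  have hμ : IsProbabilityMeasure μ := ⟨by simp [μ, ENNReal.inv_mul_cancel h0 ht]⟩
  refine ⟨μ.map (fun y => ‖y‖⁻¹ • y), Measure.isProbabilityMeasure_map hν.aemeasurable, ?_, ?_⟩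
  · rw [ae_map_iff hν.aemeasurable (measurableSet_eq_fun measurable_norm measurable_const)]
    refine Measure.ae_smul_measure ?_ _
    filter_upwards [ae_restrict_mem hSm] with y hy
    have : ‖y‖ ≠ 0 := by simpa using hy.2
    rw [norm_smul, norm_inv, norm_norm, inv_mul_cancel₀ this]
  · intro T
    have hTm : Measurable T := T.continuous.measurable
    refine ⟨hTm, ?_⟩
    have hpre : T ⁻¹' S = S := by
      ext y; simp [S]
    have hTr : MeasurePreserving T (volume.restrict S) (volume.restrict S) := by
      have := T.measurePreserving.restrict_preimage hSm
      rwa [hpre] at this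
    have hTμ : μ.map T = μ := by
      simp only [μ]
      rw [Measure.map_smul, hTr.map_eq]
    rw [Measure.map_map hTm hν]
    have : (T ∘ fun y : E => ‖y‖⁻¹ • y) = (fun y : E => ‖y‖⁻¹ • y) ∘ T := by
      ext y; simp
    rw [this, ← Measure.map_map hν hTm, hTμ]

lemma PK_den_pos {ζ x : E} (hζ : ‖ζ‖ = 1) (hx : ‖x‖ < 1) : 0 < ‖x - ζ‖ ^ 2 := by
  have h1 : 1 - ‖x‖ ≤ ‖x - ζ‖ := by
    have := norm_sub_norm_le ζ x
    rw [hζ, norm_sub_rev] at this; exact this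
  have : 0 < ‖x - ζ‖ := by linarith
  positivity

lemma PK_lower {j : ℕ} {ζ x : E} (hζ : ‖ζ‖ = 1) (hx : ‖x‖ < 1) :
    ((1 - ‖x‖) / (1 + ‖x‖)) ^ (j + 1) ≤ PK j ζ x := by
  have hn := norm_nonneg x
  unfold PK
  refine pow_le_pow_left₀ (div_nonneg (by linarith) (by linarith)) ?_ _
  have hd := PK_den_pos hζ hx
  rw [div_le_div_iff₀ (by linarith) hd]
  have h1 : ‖x - ζ‖ ≤ 1 + ‖x‖ := by
    have := norm_sub_le x ζ; rw [hζ] at this; linarith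
  have h2 : ‖x - ζ‖ ^ 2 ≤ (1 + ‖x‖) ^ 2 := pow_le_pow_left₀ (norm_nonneg _) h1 _
  have := mul_le_mul_of_nonneg_left h2 (show 0 ≤ 1 - ‖x‖ by linarith)
  nlinarith

lemma PK_nonneg {j : ℕ} {ζ x : E} (hx : ‖x‖ < 1) : 0 ≤ PK j ζ x := by
  unfold PK
  have hn := norm_nonneg x
  have : 0 ≤ 1 - ‖x‖ ^ 2 := by nlinarith
  positivity

lemma PK_zero {j : ℕ} {ζ : E} (hζ : ‖ζ‖ = 1) : PK j ζ 0 = 1 := by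
  simp [PK, hζ]

lemma PK_contOn {j : ℕ} {ρ : ℝ} (hρ1 : ρ < 1) :
    Continuous fun p : sphere (0:E) 1 × closedBall (0:E) ρ => PK j (p.1 : E) (p.2 : E) := by
  unfold PK
  refine Continuous.pow (Continuous.div ?_ ?_ ?_) _
  · fun_prop
  · fun_prop
  · rintro ⟨ζ, x⟩
    exact (PK_den_pos (by simp) ((mem_closedBall_zero_iff.1 x.2).trans_lt hρ1)).ne'

/-- Poisson integrals lie in the closure of the harmonic functions. -/
lemma poisson_mem [FiniteDimensional ℝ E] [MeasurableSpace E] [BorelSpace E]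
    (σ : Measure E) [IsProbabilityMeasure σ] (hσ : ∀ᵐ y ∂σ, ‖y‖ = 1)
    (e : ι → E) (he : ∀ i, ‖e i‖ = 1) (j : ℕ) (hcard : Fintype.card ι = j + 2)
    (hpars : ∀ x y : E, ∑ i, inner ℝ x (e i) * inner ℝ y (e i) = inner ℝ x y)
    {ρ : ℝ} (hρ1 : ρ < 1) (f : E → ℝ) (hf : ContinuousOn f (sphere 0 1)) :
    ∃ F ∈ (HS e j ρ).topologicalClosure, ∀ x, F x = ∫ ζ, PK j ζ x * f ζ ∂σ := by
  classical
  have hf' : Continuous fun ζ : sphere (0:E) 1 => f ζ := continuousOn_iff_continuous_domRestrict.1 hf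
  let G0 : C(sphere (0:E) 1 × closedBall (0:E) ρ, ℝ) :=
    ⟨fun p => PK j (p.1 : E) (p.2 : E) * f p.1, (PK_contOn hρ1).mul (hf'.comp continuous_fst)⟩
  let G : C(sphere (0:E) 1, C(closedBall (0:E) ρ, ℝ)) := G0.curry
  let F : E → C(closedBall (0:E) ρ, ℝ) := fun ζ => if h : ζ ∈ sphere (0:E) 1 then G ⟨ζ, h⟩ else 0
  have hFc : ContinuousOn F (sphere 0 1) := by
    rw [continuousOn_iff_continuous_domRestrict]
    have : (sphere (0:E) 1).domRestrict F = G := by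
      ext1 ζ; simp only [Set.domRestrict_apply, F]; rw [dif_pos ζ.2]
    rw [this]; exact G.continuous
  have hres : σ.restrict (sphere (0:E) 1) = σ := by
    rw [Measure.restrict_eq_self_of_ae_mem]
    filter_upwards [hσ] with y hy using mem_sphere_zero_iff_norm.2 hy
  have hFi : Integrable F σ := by
    have := hFc.integrableOn_compact (μ := σ) (isCompact_sphere (0:E) 1)
    rwa [IntegrableOn, hres] at this
  refine ⟨∫ ζ, F ζ ∂σ, ?_, fun x => ?_⟩
  · refine Convex.integral_mem (s := ((HS e j ρ).topologicalClosure : Set _))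
      (Submodule.convex _) (Submodule.isClosed_topologicalClosure _) ?_ hFi
    filter_upwards [hσ] with ζ hζ
    refine Submodule.le_topologicalClosure _ ?_
    refine ⟨f ζ • PK j ζ, fun x hx => Submodule.smul_mem _ _ (PK_mem e he j hcard hpars hζ
      ((mem_ball_zero_iff.1 hx).trans hρ1)), fun x => ?_⟩
    have h : ζ ∈ sphere (0:E) 1 := mem_sphere_zero_iff_norm.2 hζ
    simp only [F]
    rw [dif_pos h]
    simp [G, G0, mul_comm]
  · rw [ContinuousMap.integral_apply hFi]
    refine integral_congr_ae ?_
    filter_upwards [hσ] with ζ hζ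
    have h : ζ ∈ sphere (0:E) 1 := mem_sphere_zero_iff_norm.2 hζ
    simp only [F]
    rw [dif_pos h]
    simp [G, G0]

lemma integrable_PK_mul [FiniteDimensional ℝ E] [MeasurableSpace E] [BorelSpace E]
    (σ : Measure E) [IsProbabilityMeasure σ] (hσ : ∀ᵐ y ∂σ, ‖y‖ = 1) (j : ℕ)
    {x : E} (hx : ‖x‖ < 1) (f : E → ℝ) (hf : ContinuousOn f (sphere 0 1)) :
    Integrable (fun ζ => PK j ζ x * f ζ) σ := by
  have hres : σ.restrict (sphere (0:E) 1) = σ := by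
    rw [Measure.restrict_eq_self_of_ae_mem]
    filter_upwards [hσ] with y hy using mem_sphere_zero_iff_norm.2 hy
  have hc : ContinuousOn (fun ζ => PK j ζ x * f ζ) (sphere 0 1) := by
    refine ContinuousOn.mul ?_ hf
    unfold PK
    refine ContinuousOn.pow (ContinuousOn.div ?_ ?_ ?_) _
    · fun_prop
    · fun_prop
    · intro ζ hζ
      exact (PK_den_pos (by simpa using hζ) hx).ne'
  have := hc.integrableOn_compact (μ := σ) (isCompact_sphere (0:E) 1)
  rwa [IntegrableOn, hres] at this

lemma integral_PK [FiniteDimensional ℝ E] [Nonempty ι] [MeasurableSpace E] [BorelSpace E]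
    (σ : Measure E) [IsProbabilityMeasure σ] (hσ : ∀ᵐ y ∂σ, ‖y‖ = 1)
    (hT : ∀ T : E ≃ₗᵢ[ℝ] E, MeasurePreserving T σ σ)
    (e : ι → E) (he : ∀ i, ‖e i‖ = 1) (j : ℕ) (hcard : Fintype.card ι = j + 2)
    (hpars : ∀ x y : E, ∑ i, inner ℝ x (e i) * inner ℝ y (e i) = inner ℝ x y)
    {x : E} (hx : ‖x‖ < 1) : ∫ ζ, PK j ζ x ∂σ = 1 := by
  obtain ⟨F, hF, hFv⟩ := poisson_mem σ hσ e he j hcard hpars hx (fun _ => 1) continuousOn_const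
  simp only [mul_one] at hFv
  have hrad : ∀ y : E, ‖y‖ = ‖x‖ → ∫ ζ, PK j ζ y ∂σ = ∫ ζ, PK j ζ x ∂σ := by
    intro y hy
    let T : E ≃ₗᵢ[ℝ] E := (Submodule.span ℝ {y - x})ᗮ.reflection
    have hTy : T y = x := Submodule.reflection_sub hy
    rw [← (hT T).integral_comp T.toHomeomorph.measurableEmbedding (fun ζ => PK j ζ x)]
    congr 1
    ext ζ
    rw [← hTy]
    simp only [PK, ← map_sub, LinearIsometryEquiv.norm_map]
  have hc : (ContinuousMap.const _ (∫ ζ, PK j ζ x ∂σ)) ∈ (HS e j ‖x‖).topologicalClosure :=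
    Submodule.le_topologicalClosure _ ⟨fun _ => ∫ ζ, PK j ζ x ∂σ,
      fun y _ => const_mem_HarmSub e j y _, fun y => rfl⟩
  have := HS_closure_abs_le he hx.le (Submodule.sub_mem _ hF hc) (δ := 0) (fun y hy => by
    simp only [ContinuousMap.sub_apply, ContinuousMap.const_apply, hFv]
    rw [hrad y hy]; simp) ⟨0, by simp⟩
  simp only [ContinuousMap.sub_apply, ContinuousMap.const_apply, hFv] at this
  have h0 : ∫ ζ, PK j ζ (0:E) ∂σ = 1 := by
    rw [integral_congr_ae (g := fun _ => (1:ℝ))]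
    · simp
    · filter_upwards [hσ] with ζ hζ using PK_zero hζ
  rw [h0] at this
  have := abs_nonpos_iff.1 this
  linarith

/-- Sharp Harnack inequality. -/
lemma harnack_s14 [FiniteDimensional ℝ E] [Nontrivial E] [Nonempty ι] 
    (e : ι → E) (he : ∀ i, ‖e i‖ = 1) (j : ℕ) (hcard : Fintype.card ι = j + 2)
    (hpars : ∀ x y : E, ∑ i, inner ℝ x (e i) * inner ℝ y (e i) = inner ℝ x y)
    (w : E → ℝ) (hw : ContinuousOn w (closedBall 0 1)) (hh : ∀ x ∈ ball (0:E) 1, w ∈ HarmSub e j x)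
    (h0 : ∀ x ∈ closedBall (0:E) 1, 0 ≤ w x) {z : E} (hz : ‖z‖ < 1) :
    ((1 - ‖z‖) / (1 + ‖z‖)) ^ (j + 1) * w 0 ≤ w z := by
  borelize E
  obtain ⟨σ, hσp, hσ, hT⟩ := exists_sphere_measure (E := E)
  set c := ((1 - ‖z‖) / (1 + ‖z‖)) ^ (j + 1) with hc
  have hc0 : 0 ≤ c := pow_nonneg (div_nonneg (by linarith) (by positivity)) _
  have hc1 : c ≤ 1 := pow_le_one₀ (div_nonneg (by linarith) (by positivity))
    ((div_le_one (by positivity)).2 (by linarith [norm_nonneg z]))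
  have hws : ContinuousOn w (sphere 0 1) := hw.mono sphere_subset_closedBall
  obtain ⟨B, hB⟩ := (isCompact_closedBall (0:E) 1).exists_bound_of_continuousOn hw
  have hB0 : 0 ≤ B := (norm_nonneg _).trans (hB 0 (by simp))
  let V : E → ℝ := fun x => ∫ ζ, PK j ζ x * w ζ ∂σ
  have hI1 : ∀ x : E, ‖x‖ < 1 → Integrable (fun ζ => PK j ζ x) σ := fun x hx => by
    simpa using integrable_PK_mul σ hσ j hx (fun _ => 1) continuousOn_const
  -- boundary approximation
  have happ : ∀ ε > 0, ∃ ρ < 1, ‖z‖ ≤ ρ ∧ ∀ x : E, ‖x‖ = ρ → |w x - V x| ≤ 2 * ε := by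
    intro ε hε
    have huc := (isCompact_closedBall (0:E) 1).uniformContinuousOn_of_continuous hw
    obtain ⟨δ, hδ, hδw⟩ := Metric.uniformContinuousOn_iff.1 huc ε hε
    have hlim : Tendsto (fun ρ : ℝ => 2 * B * ((1 - ρ ^ 2) / δ ^ 2) ^ (j + 1)) (𝓝[<] 1) (𝓝 0) := by
      have : ContinuousAt (fun ρ : ℝ => 2 * B * ((1 - ρ ^ 2) / δ ^ 2) ^ (j + 1)) 1 := by fun_prop
      have h := this.tendsto
      simp only [one_pow, sub_self, zero_div, ne_eq, Nat.add_eq_zero_iff, one_ne_zero, and_false,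
        not_false_eq_true, zero_pow, mul_zero] at h
      exact h.mono_left nhdsWithin_le_nhds
    have hev := (hlim.eventually_lt_const hε).and
      ((Ioo_mem_nhdsLT hz : Set.Ioo ‖z‖ 1 ∈ 𝓝[<] (1:ℝ)))
    obtain ⟨ρ, hρ, hρz, hρ1⟩ := hev.exists
    refine ⟨ρ, hρ1, hρz.le, fun x hx => ?_⟩
    have hx1 : ‖x‖ < 1 := by rw [hx]; exact hρ1
    have hIx := hI1 x hx1
    have hIw := integrable_PK_mul σ hσ j hx1 w hws
    have e1 : w x - V x = ∫ ζ, (PK j ζ x * w x - PK j ζ x * w ζ) ∂σ := by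
      rw [integral_sub (hIx.mul_const _) hIw, integral_mul_const,
        integral_PK σ hσ hT e he j hcard hpars hx1, one_mul]
    rw [e1, ← Real.norm_eq_abs]
    have e2 : ∫ ζ, (PK j ζ x * ε + ε) ∂σ = 2 * ε := by
      rw [integral_add (hIx.mul_const _) (integrable_const _), integral_mul_const,
        integral_PK σ hσ hT e he j hcard hpars hx1]
      simp; ring
    rw [← e2]
    refine norm_integral_le_of_norm_le ((hIx.mul_const _).add (integrable_const _)) ?_
    filter_upwards [hσ] with ζ hζ
    have hP := PK_nonneg (j := j) (ζ := ζ) hx1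
    have hζc : ζ ∈ closedBall (0:E) 1 := by simp [hζ]
    have hxc : x ∈ closedBall (0:E) 1 := by simp [hx1.le]
    rw [← mul_sub, norm_mul, Real.norm_of_nonneg hP]
    by_cases hd : dist x ζ < δ
    · have := (hδw x hxc ζ hζc hd).le
      rw [Real.dist_eq] at this
      have := mul_le_mul_of_nonneg_left this hP
      rw [Real.norm_eq_abs]; linarith
    · push Not at hd
      rw [dist_eq_norm] at hd
      have h1 : ‖w x - w ζ‖ ≤ 2 * B := by
        have := norm_sub_le (w x) (w ζ)
        linarith [hB x hxc, hB ζ hζc]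
      have ha : 0 ≤ 1 - ρ ^ 2 := by rw [← hx]; nlinarith [norm_nonneg x]
      have h2 : PK j ζ x ≤ ((1 - ρ ^ 2) / δ ^ 2) ^ (j + 1) := by
        unfold PK
        rw [hx]
        gcongr
      have h3 : PK j ζ x * ‖w x - w ζ‖ ≤ ((1 - ρ ^ 2) / δ ^ 2) ^ (j + 1) * (2 * B) :=
        mul_le_mul h2 h1 (norm_nonneg _) (by positivity)
      have h4 : 0 ≤ PK j ζ x * ε := by positivity
      linarith
  refine le_of_forall_pos_le_add fun ε hε => ?_
  obtain ⟨ρ, hρ1, hρz, hρ⟩ := happ (ε / 4) (by positivity)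
  obtain ⟨F, hF, hFv⟩ := poisson_mem σ hσ e he j hcard hpars hρ1 w hws
  have hsub : closedBall (0:E) ρ ⊆ closedBall 0 1 := closedBall_subset_closedBall hρ1.le
  let W : C(closedBall (0:E) ρ, ℝ) :=
    ⟨fun x => w x, continuousOn_iff_continuous_domRestrict.1 (hw.mono hsub)⟩
  have hW : W ∈ (HS e j ρ).topologicalClosure := Submodule.le_topologicalClosure _
    ⟨w, fun x hx => hh x (ball_subset_ball hρ1.le hx), fun x => rfl⟩
  have key := HS_closure_abs_le he hρ1.le (Submodule.sub_mem _ hW hF) (δ := 2 * (ε / 4))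
    (fun y hy => by
      simp only [ContinuousMap.sub_apply, hFv]
      exact hρ y hy)
  have k0 := key ⟨0, by simpa using (norm_nonneg z).trans hρz⟩
  have kz := key ⟨z, by simpa using hρz⟩
  simp only [ContinuousMap.sub_apply, hFv] at k0 kz
  have k0' : |w 0 - V 0| ≤ 2 * (ε / 4) := k0
  have kz' : |w z - V z| ≤ 2 * (ε / 4) := kz
  have hV : c * V 0 ≤ V z := by
    simp only [V]
    rw [← integral_const_mul]
    refine integral_mono_ae ((integrable_PK_mul σ hσ j (by simp) w hws).const_mul c)
      (integrable_PK_mul σ hσ j hz w hws) ?_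
    filter_upwards [hσ] with ζ hζ
    have hζc : ζ ∈ closedBall (0:E) 1 := by simp [hζ]
    simp only [PK_zero hζ, one_mul]
    exact mul_le_mul_of_nonneg_right (PK_lower hζ hz) (h0 ζ hζc)
  have a1 := (abs_le.1 k0').2
  have a2 := (abs_le.1 kz').1
  have : c * (w 0 - V 0) ≤ 1 * (2 * (ε / 4)) := by
    refine (mul_le_mul_of_nonneg_left a1 hc0).trans (mul_le_mul_of_nonneg_right hc1 (by positivity))
  nlinarith

end Harnack

section Final
open Topology Filter

def eC (n : ℕ) : Fin n ⊕ Fin n → Cn n :=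
  Sum.elim (fun k => EuclideanSpace.single k 1) (fun k => EuclideanSpace.single k Complex.I)

lemma eC_norm (n : ℕ) (i) : ‖eC n i‖ = 1 := by
  rcases i with k | k <;> simp [eC]

lemma eC_inner_inl (n : ℕ) (x : Cn n) (k : Fin n) :
    inner ℝ x (EuclideanSpace.single k (1:ℂ)) = (x k).re := by
  rw [PiLp.inner_apply, Finset.sum_eq_single k]
  · simp [Complex.inner]
  · intro b _ hb
    simp [hb]
  · simp

lemma eC_inner_inr (n : ℕ) (x : Cn n) (k : Fin n) :
    inner ℝ x (EuclideanSpace.single k Complex.I) = (x k).im := by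
  rw [PiLp.inner_apply, Finset.sum_eq_single k]
  · simp [Complex.inner]
  · intro b _ hb
    simp [hb]
  · simp

lemma eC_pars (n : ℕ) (x y : Cn n) :
    ∑ i, inner ℝ x (eC n i) * inner ℝ y (eC n i) = inner ℝ x y := by
  simp only [eC, Fintype.sum_sum_type, Sum.elim_inl, Sum.elim_inr, eC_inner_inl, eC_inner_inr]
  rw [← Finset.sum_add_distrib, PiLp.inner_apply]
  refine Finset.sum_congr rfl fun k _ => ?_
  simp [Complex.inner, mul_comm]

lemma eC_expand (n : ℕ) (z : Cn n) :
    z = ∑ k, ((z k).re • (EuclideanSpace.single k (1:ℂ) : Cn n) +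
      (z k).im • (EuclideanSpace.single k Complex.I : Cn n)) := by
  ext l
  simp only [WithLp.ofLp_sum, Finset.sum_apply, PiLp.add_apply, PiLp.smul_apply,
    PiLp.single_apply]
  rw [Finset.sum_eq_single l]
  · simp
  · intro b _ hb
    simp [hb.symm]
  · simp

lemma mem_HarmSub_of_laplaceH (n : ℕ) (hn : 1 ≤ n) (u : Cn n → ℝ)
    (hu : ContDiffOn ℝ 2 u (ball 0 1)) (z : Cn n) (hz : z ∈ ball (0 : Cn n) 1)
    (hl : laplaceH n u z = 0) : u ∈ HarmSub (eC n) (2 * n - 2) z := by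
  have hd : ∀ w ∈ ball (0 : Cn n) 1, HasFDerivAt u (fderiv ℝ u w) w := fun w hw =>
    ((hu.contDiffAt (isOpen_ball.mem_nhds hw)).differentiableAt (by norm_num)).hasFDerivAt
  have hd2 : DifferentiableAt ℝ (fderiv ℝ u) z :=
    ((hu.contDiffAt (isOpen_ball.mem_nhds hz)).fderiv_right (m := 1) (by norm_num)).differentiableAt
      (by norm_num)
  have hlin : ∀ (v : Cn n) (t : ℝ), HasDerivAt (fun s : ℝ => z + s • v) v t := fun v t => by
    simpa using ((hasDerivAt_id t).smul_const v).const_add z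
  have hev : ∀ v : Cn n, ∀ᶠ t in 𝓝 (0:ℝ), z + t • v ∈ ball (0 : Cn n) 1 := by
    intro v
    have hcont : ContinuousAt (fun t : ℝ => z + t • v) 0 := by fun_prop
    exact hcont.eventually_mem (isOpen_ball.mem_nhds (by simpa using hz))
  refine ⟨fun i => fderiv ℝ (fun w => fderiv ℝ u w (eC n i)) z (eC n i), fderiv ℝ u z z,
    fun i => ⟨fun t => fderiv ℝ u (z + t • eC n i) (eC n i), ?_, ?_⟩, ?_, ?_⟩
  · filter_upwards [hev (eC n i)] with t ht
    exact (hd _ ht).comp_hasDerivAt t (hlin _ t)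
  · have h : DifferentiableAt ℝ (fun w => fderiv ℝ u w (eC n i)) z := by fun_prop
    have h' : HasFDerivAt (fun w => fderiv ℝ u w (eC n i))
        (fderiv ℝ (fun w => fderiv ℝ u w (eC n i)) z) (z + (0:ℝ) • eC n i) := by
      simpa using h.hasFDerivAt
    exact h'.comp_hasDerivAt (0:ℝ) (hlin (eC n i) 0)
  · have h' : HasFDerivAt u (fderiv ℝ u z) (z + (0:ℝ) • z) := by
      simpa using hd z hz
    exact h'.comp_hasDerivAt (0:ℝ) (hlin z 0)
  · have hz1 : ‖z‖ < 1 := mem_ball_zero_iff.1 hz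
    have ha : 1 - ‖z‖ ^ 2 ≠ 0 := by nlinarith [norm_nonneg z]
    have hDz : fderiv ℝ u z z = ∑ k, ((z k).re * fderiv ℝ u z (EuclideanSpace.single k 1) +
            (z k).im * fderiv ℝ u z (EuclideanSpace.single k Complex.I)) := by
      conv_lhs => rw [eC_expand n z]
      conv_lhs => arg 1; rw [← eC_expand n z]
      simp only [map_sum, map_add, map_smul, smul_eq_mul]
    have hc : ((2 * n - 2 : ℕ) : ℝ) = 2 * ((n:ℝ) - 1) := by
      rw [Nat.cast_sub (by omega)]; push_cast; ring
    rw [hc, hDz]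
    apply mul_left_cancel₀ ha
    unfold laplaceH at hl
    simp only [eC, Fintype.sum_sum_type, Sum.elim_inl, Sum.elim_inr]
    rw [← Finset.sum_add_distrib]
    linear_combination hl

lemma euclNorm_eq (n : ℕ) (v : Fin n → ℂ) : euclNorm n v = ‖(WithLp.toLp 2 v : Cn n)‖ := by
  rw [euclNorm, EuclideanSpace.norm_eq]
  simp [Complex.normSq_eq_norm_sq]

lemma euclNorm_le_matOpNorm (n : ℕ) (A : Matrix (Fin n) (Fin n) ℂ) (θ : Cn n)
    (hθ : θ ∈ sphere (0 : Cn n) 1) : euclNorm n (A.mulVec fun k => θ k) ≤ matOpNorm n A := by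
  refine le_csSup ?_ ⟨θ, hθ, rfl⟩
  refine ((isCompact_sphere (0 : Cn n) 1).image ?_).bddAbove
  unfold euclNorm Matrix.mulVec dotProduct
  refine Real.continuous_sqrt.comp (continuous_finsetSum _ fun k _ => ?_)
  refine Complex.continuous_normSq.comp ?_
  fun_prop

end Final

/-- Let `A` be an `n×n` matrix-valued function on `Bⁿ(r) ⊂ ℂⁿ`, with entries
continuous on the closed ball and hyperbolic-harmonic after rescaling to the unit ball. If
`A(0) = 0` and `|A(z)| ≤ M` on `Bⁿ(r)` (operator norm), then
`|A(z)| ≤ M (1 − ((r−|z|)/(r+|z|))^{2n−1})` on `Bⁿ(r)`. -/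
theorem matrix_schwarz_lemma (n : ℕ) (hn : 1 ≤ n) (r M : ℝ) (hr : 0 < r) (hM : 0 < M)
    (A : Cn n → Matrix (Fin n) (Fin n) ℂ)
    (hcont : ∀ i j, ContinuousOn (fun z => A z i j) (closedBall 0 r))
    (hh : ∀ i j, IsHHarmonic n (fun z => A (r • z) i j))
    (hA0 : A 0 = 0)
    (hbd : ∀ z ∈ ball (0 : Cn n) r, matOpNorm n (A z) ≤ M)
    (z : Cn n) (hz : z ∈ ball (0 : Cn n) r) :
    matOpNorm n (A z) ≤ M * (1 - ((r - ‖z‖) / (r + ‖z‖)) ^ (2 * n - 1)) := by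
  classical
  have hz' : ‖z‖ < r := mem_ball_zero_iff.1 hz
  have hq0 : 0 ≤ (r - ‖z‖) / (r + ‖z‖) := div_nonneg (by linarith) (by positivity)
  have hq1 : (r - ‖z‖) / (r + ‖z‖) ≤ 1 :=
    (div_le_one (by positivity)).2 (by linarith [norm_nonneg z])
  have hc1 : ((r - ‖z‖) / (r + ‖z‖)) ^ (2 * n - 1) ≤ 1 := pow_le_one₀ hq0 hq1
  unfold matOpNorm
  refine Real.sSup_le ?_ (mul_nonneg hM.le (by linarith))
  rintro _ ⟨θ, hθ, rfl⟩
  simp only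
  set v : Cn n := WithLp.toLp 2 ((A z).mulVec fun k => θ k) with hv
  rw [euclNorm_eq, ← hv]
  -- the scalar function
  let U : Cn n → Cn n := fun x => WithLp.toLp 2 ((A (r • x)).mulVec fun k => θ k)
  let w : Cn n → ℝ := fun x => ‖v‖ * M - inner ℝ v (U x)
  have hwexp : w = (fun _ => ‖v‖ * M) + ∑ i, ∑ l,
      ((-((v i).re * (θ l).re + (v i).im * (θ l).im)) • (fun x => (A (r • x) i l).re) +
       ((v i).re * (θ l).im - (v i).im * (θ l).re) • (fun x => (A (r • x) i l).im)) := by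
    ext x
    simp only [w, U, Pi.add_apply, Finset.sum_apply, Pi.smul_apply, smul_eq_mul]
    rw [sub_eq_add_neg, PiLp.inner_apply, ← Finset.sum_neg_distrib]
    congr 1
    refine Finset.sum_congr rfl fun i _ => ?_
    simp only [Complex.inner, Matrix.mulVec, dotProduct]
    rw [Finset.sum_mul, Complex.re_sum, ← Finset.sum_neg_distrib]
    refine Finset.sum_congr rfl fun l _ => ?_
    simp only [Complex.mul_re, Complex.mul_im, Complex.conj_re, Complex.conj_im]
    ring
  have hmaps : ∀ x ∈ closedBall (0 : Cn n) 1, r • x ∈ closedBall (0 : Cn n) r := by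
    intro x hx
    rw [mem_closedBall_zero_iff] at hx ⊢
    rw [norm_smul, Real.norm_of_nonneg hr.le]
    nlinarith
  have hmapsb : ∀ x ∈ ball (0 : Cn n) 1, r • x ∈ ball (0 : Cn n) r := by
    intro x hx
    rw [mem_ball_zero_iff] at hx ⊢
    rw [norm_smul, Real.norm_of_nonneg hr.le]
    nlinarith
  have hAc : ∀ i l, ContinuousOn (fun x => A (r • x) i l) (closedBall 0 1) := fun i l =>
    (hcont i l).comp (by fun_prop) hmaps
  have hwc : ContinuousOn w (closedBall 0 1) := by
    rw [hwexp]
    refine ContinuousOn.add continuousOn_const ?_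
    have : ∀ i l, ContinuousOn ((-((v i).re * (θ l).re + (v i).im * (θ l).im)) • (fun x => (A (r • x) i l).re) +
       ((v i).re * (θ l).im - (v i).im * (θ l).re) • (fun x => (A (r • x) i l).im)) (closedBall 0 1) := by
      intro i l
      refine ContinuousOn.add ?_ ?_
      · exact continuousOn_const.smul (Complex.continuous_re.comp_continuousOn (hAc i l))
      · exact continuousOn_const.smul (Complex.continuous_im.comp_continuousOn (hAc i l))
    have h2 := continuousOn_finsetSum (Finset.univ : Finset (Fin n)) (fun i _ =>
      continuousOn_finsetSum (Finset.univ : Finset (Fin n)) (fun l _ => this i l))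
    convert h2 using 1
    ext x
    simp
  have hwh : ∀ x ∈ ball (0 : Cn n) 1, w ∈ HarmSub (eC n) (2 * n - 2) x := by
    intro x hx
    rw [hwexp]
    refine Submodule.add_mem _ (const_mem_HarmSub _ _ _ _) (Submodule.sum_mem _ fun i _ =>
      Submodule.sum_mem _ fun l _ => Submodule.add_mem _ (Submodule.smul_mem _ _ ?_)
        (Submodule.smul_mem _ _ ?_))
    · exact mem_HarmSub_of_laplaceH n hn _ (Complex.reCLM.contDiff.comp_contDiffOn (hh i l).1) x hx
        ((hh i l).2 x hx).1
    · exact mem_HarmSub_of_laplaceH n hn _ (Complex.imCLM.contDiff.comp_contDiffOn (hh i l).1) x hx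
        ((hh i l).2 x hx).2
  have hw0 : ∀ x ∈ closedBall (0 : Cn n) 1, 0 ≤ w x := by
    have hb : ∀ x ∈ ball (0 : Cn n) 1, 0 ≤ w x := by
      intro x hx
      have h1 : inner ℝ v (U x) ≤ ‖v‖ * ‖U x‖ := real_inner_le_norm _ _
      have h2 : ‖U x‖ ≤ M := by
        have := (euclNorm_le_matOpNorm n (A (r • x)) θ hθ).trans (hbd _ (hmapsb x hx))
        rwa [euclNorm_eq] at this
      have := mul_le_mul_of_nonneg_left h2 (norm_nonneg v)
      simp only [w]
      linarith
    intro x hx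
    rw [← closure_ball (0 : Cn n) one_ne_zero] at hx hwc
    have := closure_minimal (s := ball (0 : Cn n) 1) (t := closure (ball (0 : Cn n) 1) ∩ w ⁻¹' Set.Ici 0)
      (fun y hy => ⟨subset_closure hy, hb y hy⟩)
      (hwc.preimage_isClosed_of_isClosed isClosed_closure isClosed_Ici)
    exact (this hx).2
  have : Nonempty (Fin n) := ⟨⟨0, hn⟩⟩
  have : Nontrivial (Cn n) := ⟨⟨EuclideanSpace.single ⟨0, hn⟩ 1, 0, by
    intro h; have := congrArg norm h; simp at this⟩⟩
  have hzr : ‖r⁻¹ • z‖ = ‖z‖ / r := by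
    rw [norm_smul, norm_inv, Real.norm_of_nonneg hr.le]; ring
  have H := harnack_s14 (eC n) (eC_norm n) (2 * n - 2) (by simp; omega) (eC_pars n) w hwc hwh hw0
    (z := r⁻¹ • z) (by rw [hzr, div_lt_one hr]; exact hz')
  rw [hzr, show 2 * n - 2 + 1 = 2 * n - 1 by omega] at H
  have hq : (1 - ‖z‖ / r) / (1 + ‖z‖ / r) = (r - ‖z‖) / (r + ‖z‖) := by
    have : r + ‖z‖ ≠ 0 := by positivity
    have : 1 + ‖z‖ / r ≠ 0 := by positivity
    field_simp
  have e0 : w 0 = ‖v‖ * M := by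
    have : U 0 = 0 := by simp [U, hA0]
    simp only [w, this, inner_zero_right, sub_zero]
  have ez : w (r⁻¹ • z) = ‖v‖ * M - ‖v‖ ^ 2 := by
    have : U (r⁻¹ • z) = v := by simp only [U, smul_inv_smul₀ hr.ne', hv]
    simp only [w, this, real_inner_self_eq_norm_sq]
  rw [hq, e0, ez] at H
  rcases (norm_nonneg v).eq_or_lt with h | h
  · rw [← h]; exact mul_nonneg hM.le (by linarith)
  · refine le_of_mul_le_mul_left ?_ h
    nlinarith
end
end
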